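/- arXiv:2312.02680 — 11 statements merged into one kernel-verified Lean document; each statement's English description precedes it below -/
import Mathlib

section
/- Let G be a finite simple graph, let x be a pendant vertex of G (a vertex of degree 1) and let y be the unique neighbor of x. Then n(G) = n(G − x − y) + 1 and p(G) = p(G − x − y) + 1, where G − x − y is the induced subgraph of G on V(G) \ {x, y}. -/
/-- The real adjacency matrix of a simple graph is Hermitian. -/
lemma SimpleGraph.adjMatrix_isHermitian {V : Type*} [Fintype V] [DecidableEq V]
    (G : SimpleGraph V) [DecidableRel G.Adj] : (G.adjMatrix ℝ).IsHermitian := by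
  rw [Matrix.IsHermitian, Matrix.conjTranspose_eq_transpose_of_trivial]
  exact G.isSymm_adjMatrix

/-- The negative inertia index `n(G)`: the number of negative eigenvalues of the real
adjacency matrix of `G`, counted with multiplicity. -/
noncomputable def SimpleGraph.negInertia {V : Type*} [Fintype V] (G : SimpleGraph V) : ℕ := by
  classical
  exact Fintype.card {i // (G.adjMatrix_isHermitian).eigenvalues i < 0}

/-- The positive inertia index `p(G)`: the number of positive eigenvalues of the real
adjacency matrix of `G`, counted with multiplicity. -/
noncomputable def SimpleGraph.posInertia {V : Type*} [Fintype V] (G : SimpleGraph V) : ℕ := by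
  classical
  exact Fintype.card {i // 0 < (G.adjMatrix_isHermitian).eigenvalues i}

open QuadraticMap in
/-- A quadratic form written as a weighted sum of squares of `finrank` many jointly injective
linear forms is equivalent to that weighted sum of squares. -/
lemma QuadraticForm.equivalent_weightedSumSquares_of_injective {M ι : Type*} [AddCommGroup M]
    [Module ℝ M] [FiniteDimensional ℝ M] [Fintype ι] (Q : QuadraticForm ℝ M) (w : ι → ℝ)
    (f : M →ₗ[ℝ] (ι → ℝ)) (hf : Function.Injective f)
    (hcard : Module.finrank ℝ M = Fintype.card ι)
    (hQ : ∀ v, Q v = ∑ i, w i * (f v i * f v i)) :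
    Equivalent Q (weightedSumSquares ℝ w) := by
  refine ⟨⟨LinearEquiv.ofInjectiveOfFinrankEq f hf (by simpa using hcard), fun v => ?_⟩⟩
  simp [weightedSumSquares_apply, hQ]

open scoped Matrix in
/-- The quadratic form of a real symmetric matrix is the sum of squares of the coordinates in
an eigenbasis, weighted by the eigenvalues. -/
lemma Matrix.IsHermitian.exists_dotProduct_mulVec_eq_sum_eigenvalues {n : Type*} [Fintype n]
    [DecidableEq n] {A : Matrix n n ℝ} (hA : A.IsHermitian) :
    ∃ f : (n → ℝ) →ₗ[ℝ] (n → ℝ), Function.Injective f ∧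
      ∀ v, v ⬝ᵥ A *ᵥ v = ∑ i, hA.eigenvalues i * (f v i * f v i) := by
  set U := (hA.eigenvectorUnitary : Matrix n n ℝ)
  have hU : U * star U = 1 := Unitary.coe_mul_star_self _
  have hspec : A = U * diagonal hA.eigenvalues * star U := by
    simpa [Unitary.conjStarAlgAut_apply] using hA.spectral_theorem
  have hstar : star U = Uᵀ := by
    rw [star_eq_conjTranspose, conjTranspose_eq_transpose_of_trivial]
  refine ⟨(star U).mulVecLin, ?_, fun v => ?_⟩
  · refine Function.LeftInverse.injective (g := U.mulVecLin) fun v => ?_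
    simp [hU]
  · have : v ⬝ᵥ A *ᵥ v = (star U *ᵥ v) ⬝ᵥ diagonal hA.eigenvalues *ᵥ (star U *ᵥ v) := by
      conv_lhs => rw [hspec]
      rw [← mulVec_mulVec, ← mulVec_mulVec, dotProduct_mulVec, hstar, ← mulVec_transpose]
    rw [this, dotProduct]
    refine Finset.sum_congr rfl fun i _ => ?_
    rw [mulVec_diagonal, mulVecLin_apply]
    ring

/-- The adjacency form of a graph is a weighted sum of squares of independent linear forms, where
the inertia indices count the weights of each sign. -/
lemma SimpleGraph.exists_weights_inertia {V : Type*} [Fintype V] [DecidableEq V]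
    (G : SimpleGraph V) [DecidableRel G.Adj] :
    ∃ (w : V → ℝ) (f : (V → ℝ) →ₗ[ℝ] (V → ℝ)), Function.Injective f ∧
      (∀ v, v ⬝ᵥ (G.adjMatrix ℝ).mulVec v = ∑ i, w i * (f v i * f v i)) ∧
      G.negInertia = {i | w i < 0}.ncard ∧ G.posInertia = {i | 0 < w i}.ncard := by
  classical
  obtain ⟨f, hf, hQ⟩ := G.adjMatrix_isHermitian.exists_dotProduct_mulVec_eq_sum_eigenvalues
  refine ⟨_, f, hf, hQ, ?_, ?_⟩
  · rw [← Nat.card_coe_set_eq, SimpleGraph.negInertia, ← Nat.card_eq_fintype_card]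
    simp only [Set.coe_ofPred]
    congr!
  · rw [← Nat.card_coe_set_eq, SimpleGraph.posInertia, ← Nat.card_eq_fintype_card]
    simp only [Set.coe_ofPred]
    congr!

open QuadraticForm in
/-- The inertia indices of a graph can be computed from any expression of its adjacency form as a
weighted sum of squares of independent linear forms. -/
lemma SimpleGraph.inertia_eq_of_sum_squares {V ι : Type*} [Fintype V] [DecidableEq V] [Fintype ι]
    (G : SimpleGraph V) [DecidableRel G.Adj] (w : ι → ℝ) (f : (V → ℝ) →ₗ[ℝ] (ι → ℝ))
    (hf : Function.Injective f) (hcard : Fintype.card V = Fintype.card ι)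
    (hQ : ∀ v, v ⬝ᵥ (G.adjMatrix ℝ).mulVec v = ∑ i, w i * (f v i * f v i)) :
    G.negInertia = {i | w i < 0}.ncard ∧ G.posInertia = {i | 0 < w i}.ncard := by
  obtain ⟨w', f', hf', hQ', hn, hp⟩ := G.exists_weights_inertia
  let Q : QuadraticForm ℝ (V → ℝ) := (QuadraticMap.weightedSumSquares ℝ w').comp f'
  have hQw' : ∀ v, Q v = ∑ i, w' i * (f' v i * f' v i) := fun v => by
    simp [Q, QuadraticMap.weightedSumSquares_apply]
  have e' := equivalent_weightedSumSquares_of_injective Q w' f' hf' (by simp) hQw'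
  have e := equivalent_weightedSumSquares_of_injective Q w f hf (by simpa using hcard)
    fun v => by rw [hQw', ← hQ', hQ]
  rw [hn, hp, ← sigNeg_of_equiv_weightedSumSquares e', ← sigPos_of_equiv_weightedSumSquares e']
  exact ⟨sigNeg_of_equiv_weightedSumSquares e, sigPos_of_equiv_weightedSumSquares e⟩

/-- A sum over a finite type, with two distinct terms split off. -/
lemma Fintype.sum_eq_add_add_sum_subtype {V M : Type*} [Fintype V] [DecidableEq V]
    [AddCommMonoid M] {x y : V} (hxy : x ≠ y) (g : V → M) :
    ∑ z, g z = g x + g y + ∑ z : {z : V | z ≠ x ∧ z ≠ y}, g z := by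
  rw [← Finset.add_sum_erase _ _ (Finset.mem_univ x),
    ← Finset.add_sum_erase _ _ (Finset.mem_erase.2 ⟨hxy.symm, Finset.mem_univ y⟩), add_assoc]
  congr 2
  exact Finset.sum_subtype _ (fun z => by simp [and_comm]) g

/-- The only vertex adjacent to a vertex of degree one is its given neighbor. -/
lemma SimpleGraph.adj_iff_eq_of_degree_eq_one {V : Type*} (G : SimpleGraph V) {x y : V}
    [Fintype (G.neighborSet x)] (hdeg : G.degree x = 1) (hxy : G.Adj x y) (z : V) :
    G.Adj x z ↔ z = y := by
  obtain ⟨a, ha⟩ := Finset.card_eq_one.1 hdeg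
  have key : ∀ z, G.Adj x z ↔ z = a := fun z => by
    rw [← G.mem_neighborFinset, ha, Finset.mem_singleton]
  rw [key, (key y).1 hxy]

/-- The adjacency form of a graph with a pendant vertex `x` attached to `y` is the adjacency form
of the graph without `x` and `y` plus a hyperbolic plane. -/
lemma SimpleGraph.dotProduct_adjMatrix_mulVec_of_pendant {V : Type*} [Fintype V] [DecidableEq V]
    (G : SimpleGraph V) [DecidableRel G.Adj] {x y : V}
    (hdeg : G.degree x = 1) (hxy : G.Adj x y) (v : V → ℝ) :
    v ⬝ᵥ (G.adjMatrix ℝ).mulVec v =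
      (fun z : {z : V | z ≠ x ∧ z ≠ y} => v z) ⬝ᵥ
        ((G.induce {z : V | z ≠ x ∧ z ≠ y}).adjMatrix ℝ).mulVec (fun z => v z) +
      2 * (v y * (G.adjMatrix ℝ).mulVec v y) := by
  have hx := G.adj_iff_eq_of_degree_eq_one hdeg hxy
  have hx' : ∀ z, G.Adj z x ↔ z = y := fun z => by rw [G.adj_comm, hx]
  have hS : ∀ z : {z : V | z ≠ x ∧ z ≠ y}, (z : V) ≠ y := fun z => z.2.2
  rw [two_mul]
  simp only [dotProduct, Matrix.mulVec, SimpleGraph.adjMatrix_apply,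
    Fintype.sum_eq_add_add_sum_subtype hxy.ne, hx, hx', hxy.ne, hS, G.adj_comm y,
    SimpleGraph.irrefl, SimpleGraph.comap_adj, Function.Embedding.subtype_apply, mul_add,
    Finset.sum_add_distrib]
  simp only [Finset.mul_sum, mul_ite, mul_zero, ite_mul, one_mul, zero_mul, if_true,
    if_false, add_zero, zero_add, Finset.sum_const_zero, mul_comm (v _) (v y)]
  ring

/-- If `x` is a pendant vertex of `G` with unique neighbor `y`, then
`n(G) = n(G - x - y) + 1` and `p(G) = p(G - x - y) + 1`. -/
theorem negInertia_posInertia_delete_pendant {V : Type*} [Fintype V] [DecidableEq V]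
    (G : SimpleGraph V) [DecidableRel G.Adj] (x y : V)
    (hdeg : G.degree x = 1) (hxy : G.Adj x y) :
    G.negInertia = (G.induce {z : V | z ≠ x ∧ z ≠ y}).negInertia + 1 ∧
    G.posInertia = (G.induce {z : V | z ≠ x ∧ z ≠ y}).posInertia + 1 := by
  have hne := hxy.ne
  obtain ⟨w, f, hf, hQ, hn, hp⟩ := (G.induce {z : V | z ≠ x ∧ z ≠ y}).exists_weights_inertia
  let s : (V → ℝ) →ₗ[ℝ] ℝ := LinearMap.proj y ∘ₗ (G.adjMatrix ℝ).mulVecLin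
  let t : (V → ℝ) →ₗ[ℝ] ℝ := LinearMap.proj y
  let r : (V → ℝ) →ₗ[ℝ] ({z : V | z ≠ x ∧ z ≠ y} → ℝ) := LinearMap.funLeft ℝ ℝ (↑)
  let F : (V → ℝ) →ₗ[ℝ] (Option (Option {z : V | z ≠ x ∧ z ≠ y}) → ℝ) :=
    LinearMap.pi fun o => o.elim (t + s) fun o => o.elim (t - s) fun z => LinearMap.proj z ∘ₗ f ∘ₗ r
  let W : Option (Option {z : V | z ≠ x ∧ z ≠ y}) → ℝ :=
    fun o => o.elim (1 / 2) fun o => o.elim (-1 / 2) w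
  have hF : Function.Injective F := by
    rw [injective_iff_map_eq_zero]
    intro v hv
    have hadd : v y + (G.adjMatrix ℝ).mulVec v y = 0 := congrFun hv none
    have hsub : v y - (G.adjMatrix ℝ).mulVec v y = 0 := congrFun hv (some none)
    have hr : r v = 0 := (injective_iff_map_eq_zero f).1 hf _ <|
      funext fun z => congrFun hv (some (some z))
    have hz : ∀ z : {z : V | z ≠ x ∧ z ≠ y}, v z = 0 := fun z => congrFun hr z
    have hvy : v y = 0 := by linarith
    have hvx : v x = 0 := by
      have hy : (G.adjMatrix ℝ).mulVec v y = 0 := by linarith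
      simpa [Matrix.mulVec, dotProduct, Fintype.sum_eq_add_add_sum_subtype hne,
        SimpleGraph.adjMatrix_apply, hxy.symm, hz, -SimpleGraph.adjMatrix_mulVec_apply] using hy
    funext z
    by_cases hzx : z = x
    · rw [hzx, hvx, Pi.zero_apply]
    by_cases hzy : z = y
    · rw [hzy, hvy, Pi.zero_apply]
    exact hz ⟨z, hzx, hzy⟩
  have hcard : Fintype.card V = Fintype.card (Option (Option {z : V | z ≠ x ∧ z ≠ y})) := by
    have := Fintype.sum_eq_add_add_sum_subtype hne (fun _ => 1)
    simp only [Finset.sum_const, Finset.card_univ, smul_eq_mul, mul_one] at this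
    rw [Fintype.card_option, Fintype.card_option, this]
    ring
  obtain ⟨hn', hp'⟩ := G.inertia_eq_of_sum_squares W F hF hcard fun v => by
    rw [G.dotProduct_adjMatrix_mulVec_of_pendant hdeg hxy, hQ]
    simp only [Fintype.sum_option, W, F, LinearMap.pi_apply, Option.elim_none, Option.elim_some,
      LinearMap.add_apply, LinearMap.sub_apply, LinearMap.comp_apply, LinearMap.proj_apply, t,
      s, Matrix.mulVecLin_apply]
    change ∑ i, w i * (f (r v) i * f (r v) i) + _ = _
    ring
  rw [hn', hp', hn, hp]
  simp only [Set.ncard_eq_toFinset_card', Set.toFinset_ofPred, Finset.card_filter,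
    Fintype.sum_option, W, Option.elim_none, Option.elim_some]
  constructor <;> norm_num only [if_true, if_false] <;> ring_nf <;> congr!
end

section
/- Let G be a finite connected simple graph whose diameter d(G) is odd, say d(G) = 2k + 1 for an integer k ≥ 0. Then n(G) ≥ k + 1; equivalently, 2·n(G) ≥ d(G) + 1. -/
open Matrix in
/-- A subspace on which the quadratic form of a real symmetric matrix is negative definite has
dimension at most the number of negative eigenvalues. -/
theorem Matrix.IsHermitian.finrank_le_card_neg_eigenvalues {n E : Type*} [Fintype n]
    [DecidableEq n] [AddCommGroup E] [Module ℝ E] {A : Matrix n n ℝ} (hA : A.IsHermitian)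
    (φ : E →ₗ[ℝ] n → ℝ) (hφ : ∀ x, x ≠ 0 → φ x ⬝ᵥ A *ᵥ φ x < 0) :
    Module.finrank ℝ E ≤ Fintype.card {i // hA.eigenvalues i < 0} := by
  let U : Matrix n n ℝ := hA.eigenvectorUnitary
  let c : E →ₗ[ℝ] n → ℝ := Uᵀ.mulVecLin ∘ₗ φ
  have hform (x : E) : φ x ⬝ᵥ A *ᵥ φ x = ∑ i, hA.eigenvalues i * c x i ^ 2 := by
    have hspec : A = U * diagonal hA.eigenvalues * Uᵀ := by
      conv_lhs => rw [hA.spectral_theorem, Unitary.conjStarAlgAut_apply]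
      simp [U, Matrix.star_eq_conjTranspose,
        Matrix.conjTranspose_eq_transpose_of_trivial]
    conv_lhs => rw [hspec]
    rw [← mulVec_mulVec, ← mulVec_mulVec, dotProduct_mulVec, ← mulVec_transpose]
    simp only [dotProduct, mulVec_diagonal]
    refine Finset.sum_congr rfl fun i _ => ?_
    change (Uᵀ *ᵥ φ x) i * (_ * (Uᵀ *ᵥ φ x) i) = _ * (Uᵀ *ᵥ φ x) i ^ 2
    ring
  let ψ : E →ₗ[ℝ] {i // hA.eigenvalues i < 0} → ℝ := LinearMap.funLeft ℝ ℝ Subtype.val ∘ₗ c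
  have hψ : Function.Injective ψ := by
    rw [injective_iff_map_eq_zero]
    intro x hx
    by_contra hne
    refine (hφ x hne).not_ge ?_
    rw [hform]
    refine Finset.sum_nonneg fun i _ => ?_
    by_cases hi : hA.eigenvalues i < 0
    · have : c x i = 0 := congrFun hx ⟨i, hi⟩
      simp [this]
    · exact mul_nonneg (not_lt.mp hi) (sq_nonneg _)
  simpa using LinearMap.finrank_le_finrank_of_injective hψ

/-- Any two vertices of a connected graph are joined by a geodesic, which is an induced
path. -/
theorem SimpleGraph.Connected.exists_induced_path {V : Type*} {G : SimpleGraph V}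
    (hG : G.Connected) (u w : V) :
    ∃ v : ℕ → V, ∀ i ≤ G.dist u w, ∀ j ≤ G.dist u w,
      (G.Adj (v i) (v j) ↔ i + 1 = j ∨ j + 1 = i) := by
  obtain ⟨p, hp⟩ := hG.exists_walk_length_eq_dist u w
  have hdist (i : ℕ) (hi : i ≤ G.dist u w) : G.dist u (p.getVert i) = i := by
    have h1 := dist_le (p.take i)
    have h2 := dist_le (p.drop i)
    have h3 := hG.dist_triangle (u := u) (v := p.getVert i) (w := w)
    rw [Walk.take_length] at h1
    rw [Walk.drop_length] at h2
    omega
  refine ⟨p.getVert, fun i hi j hj => ⟨fun h => ?_, ?_⟩⟩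
  · have hne : i ≠ j := by
      rintro rfl
      exact h.ne rfl
    have h1 := hG.dist_triangle (u := u) (v := p.getVert i) (w := p.getVert j)
    have h2 := hG.dist_triangle (u := u) (v := p.getVert j) (w := p.getVert i)
    rw [dist_eq_one_iff_adj.mpr h, hdist i hi, hdist j hj] at h1
    rw [dist_eq_one_iff_adj.mpr h.symm, hdist i hi, hdist j hj] at h2
    omega
  · rintro (rfl | rfl)
    · exact p.adj_getVert_succ (by omega)
    · exact (p.adj_getVert_succ (by omega)).symm

/-- The quadratic form of the path on `n + 1` vertices. -/
theorem sum_sum_path_adj (z : ℕ → ℝ) (n : ℕ) :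
    ∑ i ∈ Finset.range (n + 1), ∑ j ∈ Finset.range (n + 1),
      z i * z j * (if i + 1 = j ∨ j + 1 = i then 1 else 0) =
    2 * ∑ i ∈ Finset.range n, z i * z (i + 1) := by
  induction n with
  | zero => simp
  | succ n ih =>
    have hrow : ∑ j ∈ Finset.range (n + 1),
        z (n + 1) * z j * (if n + 1 + 1 = j ∨ j + 1 = n + 1 then 1 else 0) =
        z n * z (n + 1) := by
      rw [Finset.sum_eq_single_of_mem n (by simp)]
      · simp [mul_comm]
      · intro j hj hne
        rw [Finset.mem_range] at hj
        rw [if_neg (by omega), mul_zero]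
    have hcol : ∑ i ∈ Finset.range (n + 1),
        z i * z (n + 1) * (if i + 1 = n + 1 ∨ n + 1 + 1 = i then 1 else 0) =
        z n * z (n + 1) := by
      rw [← hrow]
      exact Finset.sum_congr rfl fun i _ => by simp only [or_comm, mul_comm (z i)]
    rw [Finset.sum_range_succ]
    simp only [Finset.sum_range_succ _ (n + 1)]
    rw [Finset.sum_add_distrib, ih, hcol, hrow, Finset.sum_range_succ _ n]
    simp
    ring

/-- Weights on the vertices of a path: `x i` at the vertex `2 * i`, and minus the sum of the
weights of the two neighbours at each odd vertex. -/
def pathWeight : (ℕ → ℝ) →ₗ[ℝ] ℕ → ℝ where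
  toFun x j := if Even j then x (j / 2) else -(x (j / 2) + x (j / 2 + 1))
  map_add' x y := by
    ext j
    simp only [Pi.add_apply]
    split_ifs <;> ring
  map_smul' a x := by
    ext j
    simp only [Pi.smul_apply, smul_eq_mul, RingHom.id_apply]
    split_ifs <;> ring

theorem pathWeight_two_mul (x : ℕ → ℝ) (i : ℕ) : pathWeight x (2 * i) = x i := by
  simp [pathWeight]

theorem pathWeight_two_mul_add_one (x : ℕ → ℝ) (i : ℕ) :
    pathWeight x (2 * i + 1) = -(x i + x (i + 1)) := by
  have : (2 * i + 1) / 2 = i := by omega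
  simp [pathWeight, this]

theorem sum_pathWeight_mul_succ (x : ℕ → ℝ) (m : ℕ) :
    ∑ j ∈ Finset.range (2 * m), pathWeight x j * pathWeight x (j + 1) =
      -∑ i ∈ Finset.range m, (x i + x (i + 1)) ^ 2 := by
  induction m with
  | zero => simp
  | succ m ih =>
    rw [mul_add_one, Finset.sum_range_succ, Finset.sum_range_succ, ih, Finset.sum_range_succ,
      show 2 * m + 1 + 1 = 2 * (m + 1) by ring, pathWeight_two_mul, pathWeight_two_mul,
      pathWeight_two_mul_add_one]
    ring

theorem sum_pathWeight_mul_succ_neg {x : ℕ → ℝ} {m : ℕ} (hm : ∀ i, m ≤ i → x i = 0)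
    (hx : x ≠ 0) :
    ∑ j ∈ Finset.range (2 * m), pathWeight x j * pathWeight x (j + 1) < 0 := by
  rw [sum_pathWeight_mul_succ, neg_lt_zero]
  refine (Finset.sum_nonneg fun i _ => sq_nonneg _).lt_of_ne' fun h => hx ?_
  rw [Finset.sum_eq_zero_iff_of_nonneg fun i _ => sq_nonneg _] at h
  have hle : ∀ d, x (m - d) = 0 := by
    intro d
    induction d with
    | zero => exact hm m le_rfl
    | succ d ih =>
      by_cases hd : d < m
      · have h0 := pow_eq_zero_iff two_ne_zero |>.mp (h (m - (d + 1)) (by simp; omega))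
        rwa [show m - (d + 1) + 1 = m - d by omega, ih, add_zero] at h0
      · rwa [show m - (d + 1) = m - d by omega]
  ext i
  rcases le_total m i with hi | hi
  · exact hm i hi
  · simpa [Nat.sub_sub_self hi] using hle (m - i)

/-- If `G` is connected with odd diameter `d(G) = 2k + 1`, then `n(G) ≥ k + 1`,
equivalently `2·n(G) ≥ d(G) + 1`. -/
theorem negInertia_ge_of_odd_diam {V : Type*} [Fintype V] (G : SimpleGraph V)
    (hG : G.Connected) (k : ℕ) (hd : G.diam = 2 * k + 1) :
    k + 1 ≤ G.negInertia := by
  classical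
  have := hG.nonempty
  obtain ⟨u, w, huw⟩ := G.exists_dist_eq_diam
  obtain ⟨v, hv⟩ := hG.exists_induced_path u w
  rw [huw, hd] at hv
  let extend : (Fin (k + 1) → ℝ) →ₗ[ℝ] ℕ → ℝ :=
    Function.ExtendByZero.linearMap ℝ (Fin.val : Fin (k + 1) → ℕ)
  let embed : (ℕ → ℝ) →ₗ[ℝ] V → ℝ :=
    ∑ j ∈ Finset.range (2 * k + 2), (LinearMap.single ℝ (fun _ => ℝ) (v j)) ∘ₗ LinearMap.proj j
  have hform (z : ℕ → ℝ) : embed z ⬝ᵥ (G.adjMatrix ℝ).mulVec (embed z) =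
      2 * ∑ j ∈ Finset.range (2 * k + 1), z j * z (j + 1) := by
    rw [← sum_sum_path_adj]
    simp only [embed, LinearMap.sum_apply, LinearMap.comp_apply, LinearMap.proj_apply,
      LinearMap.single_apply, Matrix.mulVec_sum, sum_dotProduct, dotProduct_sum]
    refine Finset.sum_congr rfl fun i hi => Finset.sum_congr rfl fun j hj => ?_
    rw [Finset.mem_range] at hi hj
    simp [hv j (by omega) i (by omega), or_comm]
  have key := (G.adjMatrix_isHermitian).finrank_le_card_neg_eigenvalues
    (embed ∘ₗ pathWeight ∘ₗ extend) fun x hx => ?_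
  · rw [Module.finrank_fin_fun] at key
    unfold SimpleGraph.negInertia
    convert key
  · have hzero (i : ℕ) (hi : k + 1 ≤ i) : extend x i = 0 :=
      Function.extend_apply' _ _ _ (by rintro ⟨a, rfl⟩; omega)
    have hne : extend x ≠ 0 := fun h => hx <| funext fun i => by
      simpa [extend, Fin.val_injective.extend_apply] using congrFun h i
    have hneg := sum_pathWeight_mul_succ_neg hzero hne
    rw [mul_add_one, Finset.sum_range_succ, show 2 * k + 1 + 1 = 2 * (k + 1) by ring,
      pathWeight_two_mul, hzero _ le_rfl, mul_zero, add_zero] at hneg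
    simp only [LinearMap.comp_apply, hform]
    linarith
end

section
/- Let G be a finite connected simple graph whose diameter d(G) is odd, say d(G) = 2k + 1 for an integer k ≥ 0. Then the rank of the real adjacency matrix A(G) is at least d(G) + 1 = 2k + 2. -/
/-- The vertices of a geodesic `p` at two positions are adjacent if and only if the positions
are consecutive. -/
lemma SimpleGraph.Walk.adj_getVert_iff_of_length_eq_dist {V : Type*} {G : SimpleGraph V}
    {u v : V} {p : G.Walk u v} (hp : p.length = G.dist u v) {i j : ℕ} (hi : i ≤ p.length)
    (hj : j ≤ p.length) : G.Adj (p.getVert i) (p.getVert j) ↔ j = i + 1 ∨ j + 1 = i := by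
  have key : ∀ {i j : ℕ}, i ≤ j → j ≤ p.length → G.Adj (p.getVert i) (p.getVert j) →
      j = i + 1 := by
    intro i j hij hj h
    have hne : i ≠ j := by rintro rfl; exact G.loopless.irrefl _ h
    have hlen := dist_le ((p.take i).append (cons h (p.drop j)))
    simp only [length_append, length_cons, take_length, drop_length] at hlen
    omega
  constructor
  · intro h
    rcases le_total i j with hij | hij
    · exact Or.inl (key hij hj h)
    · exact Or.inr (key hij hi h.symm).symm
  · rintro (rfl | rfl)
    · exact p.adj_getVert_succ (by omega)
    · exact (p.adj_getVert_succ (by omega)).symm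

/-- A real sequence in the kernel of the adjacency operator of the path on `0, …, 2k + 1`, with
zero boundary value at `2k + 2`, vanishes on that path. -/
lemma eq_zero_of_path_recurrence {k : ℕ} {y : ℕ → ℝ} (hodd : y 1 = 0)
    (hend : y (2 * k + 2) = 0) (hrec : ∀ i ≤ 2 * k, y i + y (i + 2) = 0) :
    ∀ i < 2 * k + 2, y i = 0 := by
  have odd : ∀ j ≤ k, y (2 * j + 1) = 0 := by
    intro j
    induction j with
    | zero => intro _; simpa using hodd
    | succ j ih =>
      intro hj
      have h1 := ih (by omega)
      have h2 := hrec (2 * j + 1) (by omega)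
      rw [show 2 * (j + 1) + 1 = 2 * j + 1 + 2 by ring]
      linarith
  have even : ∀ m ≤ k, y (2 * (k - m)) = 0 := by
    intro m
    induction m with
    | zero =>
      intro _
      have h := hrec (2 * k) le_rfl
      rw [Nat.sub_zero]
      linarith
    | succ m ih =>
      intro hm
      have h1 := ih (by omega)
      have h2 := hrec (2 * (k - (m + 1))) (by omega)
      rw [show 2 * (k - (m + 1)) + 2 = 2 * (k - m) by omega] at h2
      linarith
  intro i hi
  rcases Nat.even_or_odd' i with ⟨j, rfl | rfl⟩
  · simpa [show k - (k - j) = j by omega] using even (k - j) (by omega)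
  · exact odd j (by omega)

/-- The adjacency matrix of the path on an even number of vertices is invertible. -/
lemma isUnit_path_adjacency (k : ℕ) :
    IsUnit (Matrix.of fun i j : Fin (2 * k + 2) =>
      if (j : ℕ) = i + 1 ∨ (j : ℕ) + 1 = i then (1 : ℝ) else 0) := by
  rw [← Matrix.mulVec_injective_iff_isUnit, ← Matrix.coe_mulVecLin, injective_iff_map_eq_zero]
  intro x hx
  set y : ℕ → ℝ := fun i => if h : i < 2 * k + 2 then x ⟨i, h⟩ else 0 with hy
  have hyx : ∀ j : Fin (2 * k + 2), x j = y j := fun j => by simp [hy]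
  have hend : ∀ i, 2 * k + 2 ≤ i → y i = 0 := fun i hi => by simp [hy, hi]
  have hrow : ∀ i < 2 * k + 2,
      ∑ j ∈ Finset.range (2 * k + 2), (if j = i + 1 ∨ j + 1 = i then y j else 0) = 0 := by
    intro i hi
    have h := congrFun hx ⟨i, hi⟩
    simp only [Matrix.mulVecLin_apply, Matrix.mulVec, dotProduct, Matrix.of_apply, hyx,
      ite_mul, one_mul, zero_mul, Pi.zero_apply] at h
    rwa [Fin.sum_univ_eq_sum_range (fun j => if j = i + 1 ∨ j + 1 = i then y j else 0)] at h
  have hrec : ∀ i ≤ 2 * k, y i + y (i + 2) = 0 := by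
    intro i hi
    rw [← hrow (i + 1) (by omega)]
    have hsplit : ∀ j, (if j = i + 1 + 1 ∨ j + 1 = i + 1 then y j else 0) =
        (if j = i then y j else 0) + (if j = i + 2 then y j else 0) := by
      intro j
      split_ifs <;> first | omega | simp
    simp only [hsplit, Finset.sum_add_distrib, Finset.sum_ite_eq', Finset.mem_range]
    rw [if_pos (by omega)]
    split_ifs with h
    · rfl
    · rw [hend (i + 2) (by omega)]
  have hodd : y 1 = 0 := by
    simpa using hrow 0 (by omega)
  funext j
  rw [hyx]
  exact eq_zero_of_path_recurrence hodd (hend _ le_rfl) hrec j j.isLt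

/-- If `G` is connected with odd diameter `d(G) = 2k + 1`, then the rank of the real
adjacency matrix of `G` is at least `d(G) + 1 = 2k + 2`. -/
theorem rank_adjMatrix_ge_of_odd_diam {V : Type*} [Fintype V] [DecidableEq V]
    (G : SimpleGraph V) [DecidableRel G.Adj]
    (hG : G.Connected) (k : ℕ) (hd : G.diam = 2 * k + 1) :
    2 * k + 2 ≤ (G.adjMatrix ℝ).rank := by
  have : Nonempty V := hG.nonempty
  obtain ⟨u, v, huv⟩ := G.exists_dist_eq_diam
  obtain ⟨p, hp⟩ := hG.exists_walk_length_eq_dist u v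
  let f : Fin (2 * k + 2) → V := fun i => p.getVert i
  have hsub : (G.adjMatrix ℝ).submatrix f f = Matrix.of fun i j : Fin (2 * k + 2) =>
      if (j : ℕ) = i + 1 ∨ (j : ℕ) + 1 = i then (1 : ℝ) else 0 := by
    ext i j
    simp only [Matrix.submatrix_apply, SimpleGraph.adjMatrix_apply, Matrix.of_apply, f]
    exact if_congr (SimpleGraph.Walk.adj_getVert_iff_of_length_eq_dist hp (by omega) (by omega))
      rfl rfl
  calc 2 * k + 2 = ((G.adjMatrix ℝ).submatrix f f).rank := by
        rw [hsub, Matrix.rank_of_isUnit _ (isUnit_path_adjacency k), Fintype.card_fin]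
    _ ≤ (G.adjMatrix ℝ).rank := Matrix.rank_submatrix_le _ _ _
end

section
/- Let G be a finite connected simple graph containing a cycle, with girth g, and let C be a shortest cycle in G (a cycle of length g). If n(G) = n(C_g), where n(C_g) is the negative inertia index of the cycle graph on g vertices, then every vertex of G is at distance at most 1 from V(C), i.e., for every vertex x of G there is a vertex y on C with dist(x, y) ≤ 1. -/
namespace Matrix.IsHermitian

open Matrix

/-- The quadratic form of a Hermitian matrix in eigenvector coordinates. -/
lemma dotProduct_mulVec_eq_sum {n : Type*} [Fintype n] [DecidableEq n]
    {A : Matrix n n ℝ} (hA : A.IsHermitian) (x : n → ℝ) :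
    x ⬝ᵥ A *ᵥ x =
      ∑ i, hA.eigenvalues i * ((star (hA.eigenvectorUnitary : Matrix n n ℝ)) *ᵥ x) i ^ 2 := by
  set U := (hA.eigenvectorUnitary : Matrix n n ℝ)
  have h : A = U * diagonal hA.eigenvalues * star U := by
    have := hA.spectral_theorem
    rwa [Unitary.conjStarAlgAut_apply] at this
  have hx : x ᵥ* U = star U *ᵥ x := by
    rw [star_eq_conjTranspose, conjTranspose_eq_transpose_of_trivial, mulVec_transpose]
  conv_lhs => rw [h]
  rw [← mulVec_mulVec, ← mulVec_mulVec, dotProduct_mulVec, hx]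
  simp only [dotProduct, mulVec_diagonal]
  exact Finset.sum_congr rfl fun i _ ↦ by ring

/-- A Hermitian matrix is negative definite on the span of its eigenvectors with negative
eigenvalue. -/
lemma exists_linearMap_neg {n : Type*} [Fintype n] [DecidableEq n]
    {A : Matrix n n ℝ} (hA : A.IsHermitian) :
    ∃ f : ({i // hA.eigenvalues i < 0} → ℝ) →ₗ[ℝ] (n → ℝ),
      ∀ v ≠ 0, f v ⬝ᵥ A *ᵥ f v < 0 := by
  set U := (hA.eigenvectorUnitary : Matrix n n ℝ) with hU
  refine ⟨U.mulVecLin ∘ₗ Function.ExtendByZero.linearMap ℝ Subtype.val, fun v hv ↦ ?_⟩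
  have hUU : star U * U = 1 := Unitary.coe_star_mul_self _
  rw [hA.dotProduct_mulVec_eq_sum]
  simp only [LinearMap.comp_apply, mulVecLin_apply, ← hU, mulVec_mulVec, hUU, one_mulVec,
    Function.ExtendByZero.linearMap_apply]
  have hz : ∀ i, ¬ hA.eigenvalues i < 0 → Function.extend Subtype.val v 0 i = 0 := fun i hi ↦ by
    rw [Function.extend_apply']
    · rfl
    · rintro ⟨a, rfl⟩
      exact hi a.2
  obtain ⟨j, hj⟩ := Function.ne_iff.mp hv
  refine Finset.sum_neg' (fun i _ ↦ ?_) ⟨j, Finset.mem_univ _, ?_⟩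
  · by_cases hi : hA.eigenvalues i < 0
    · exact mul_nonpos_of_nonpos_of_nonneg hi.le (sq_nonneg _)
    · simp [hz i hi]
  · rw [Subtype.val_injective.extend_apply]
    exact mul_neg_of_neg_of_pos j.2 (sq_pos_of_ne_zero hj)

/-- A negative definite subspace of a Hermitian matrix has dimension at most the number of
negative eigenvalues. -/
lemma card_le_of_linearMap_neg {n ι : Type*} [Fintype n] [DecidableEq n]
    [Fintype ι] {A : Matrix n n ℝ} (hA : A.IsHermitian) (f : (ι → ℝ) →ₗ[ℝ] (n → ℝ))
    (hf : ∀ v ≠ 0, f v ⬝ᵥ A *ᵥ f v < 0) :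
    Fintype.card ι ≤ Fintype.card {i // hA.eigenvalues i < 0} := by
  by_contra! hlt
  set U := (hA.eigenvectorUnitary : Matrix n n ℝ) with hU
  let p : (ι → ℝ) →ₗ[ℝ] ({i // hA.eigenvalues i < 0} → ℝ) :=
    LinearMap.funLeft ℝ ℝ Subtype.val ∘ₗ (star U).mulVecLin ∘ₗ f
  obtain ⟨v, hv, hv0⟩ := p.ker.exists_mem_ne_zero_of_ne_bot
    (p.ker_ne_bot_of_finrank_lt (by simpa using hlt))
  refine (hf v hv0).not_ge ?_
  rw [hA.dotProduct_mulVec_eq_sum]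
  refine Finset.sum_nonneg fun i _ ↦ ?_
  by_cases hi : hA.eigenvalues i < 0
  · have : (star U *ᵥ f v) i = 0 := congrFun (LinearMap.mem_ker.mp hv) ⟨i, hi⟩
    simp [← hU, this]
  · exact mul_nonneg (not_lt.mp hi) (sq_nonneg _)

end Matrix.IsHermitian

open Matrix in
/-- If a vertex `x` with a neighbour `y` has no neighbour in a copy of `H` in `G`, then
`n(H) < n(G)`. -/
lemma SimpleGraph.negInertia_lt_of_adj {V W : Type*} [Fintype V] [Fintype W]
    {G : SimpleGraph V} {H : SimpleGraph W} (φ : W → V)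
    (hφ : ∀ i j, G.Adj (φ i) (φ j) ↔ H.Adj i j) {x y : V} (hxy : G.Adj x y)
    (hx : ∀ i, ¬ G.Adj x (φ i)) : H.negInertia < G.negInertia := by
  classical
  obtain ⟨f, hf⟩ := H.adjMatrix_isHermitian.exists_linearMap_neg
  set A := G.adjMatrix ℝ with hA
  let P : Matrix V W ℝ := (1 : Matrix V V ℝ).submatrix id φ
  let L := P.mulVecLin ∘ₗ f ∘ₗ LinearMap.funLeft ℝ ℝ (some : _ → Option _)
  let F : (Option _ → ℝ) →ₗ[ℝ] (V → ℝ) := L +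
    LinearMap.single ℝ (fun _ ↦ ℝ) y ∘ₗ LinearMap.proj none -
    LinearMap.single ℝ (fun _ ↦ ℝ) x ∘ₗ
      (LinearMap.proj y ∘ₗ A.mulVecLin ∘ₗ L + LinearMap.proj none)
  have hP : Pᵀ * A * P = H.adjMatrix ℝ := by
    have hPA : Pᵀ * A = A.submatrix φ id := by
      ext i j
      simp [P, Matrix.mul_apply, Matrix.one_apply]
    rw [hPA]
    ext i j
    simp [P, A, Matrix.mul_apply, Matrix.one_apply, adjMatrix_apply, hφ]
  have hAP : ∀ w, (A *ᵥ (P *ᵥ w)) x = 0 := fun w ↦ by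
    rw [Matrix.mulVec_mulVec]
    simp [P, A, Matrix.mulVec, dotProduct, Matrix.mul_apply, Matrix.one_apply, adjMatrix_apply, hx]
  have hquad : ∀ w, (P *ᵥ w) ⬝ᵥ A *ᵥ (P *ᵥ w) = w ⬝ᵥ H.adjMatrix ℝ *ᵥ w := fun w ↦ by
    rw [← hP, ← Matrix.mulVec_mulVec, ← Matrix.mulVec_mulVec, Matrix.dotProduct_mulVec w,
      Matrix.vecMul_transpose]
  have hF : ∀ v, F v ⬝ᵥ A *ᵥ F v =
      f (v ∘ some) ⬝ᵥ H.adjMatrix ℝ *ᵥ f (v ∘ some) - 2 * v none ^ 2 := fun v ↦ by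
    have hsymm : ∀ u z, u ⬝ᵥ A *ᵥ z = z ⬝ᵥ A *ᵥ u := fun u z ↦ by
      rw [Matrix.dotProduct_mulVec, dotProduct_comm, ← Matrix.mulVec_transpose,
        hA, transpose_adjMatrix]
    have hFv : F v = P *ᵥ f (v ∘ some) + Pi.single y (v none) -
        Pi.single x ((A *ᵥ (P *ᵥ f (v ∘ some))) y + v none) := rfl
    rw [hFv, ← hquad]
    have hw := hAP (f (v ∘ some))
    generalize P *ᵥ f (v ∘ some) = w at hw ⊢
    simp only [Matrix.mulVec_add, Matrix.mulVec_sub, add_dotProduct, sub_dotProduct,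
      dotProduct_add, dotProduct_sub]
    rw [hsymm w (Pi.single y _), hsymm w (Pi.single x _)]
    simp only [single_dotProduct, hw, Matrix.mulVec_single, Pi.smul_apply,
      MulOpposite.smul_eq_mul_unop]
    simp [A, adjMatrix_apply, hxy, hxy.symm]
    ring
  have := G.adjMatrix_isHermitian.card_le_of_linearMap_neg F fun v hv ↦ by
    rw [← hA, hF]
    by_cases h : v ∘ some = 0
    · have h0 : v none ≠ 0 := fun h0 ↦ hv <| funext fun o ↦ by
        cases o with
        | none => exact h0
        | some i => exact congrFun h i
      have : 0 < v none ^ 2 := by positivity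
      rw [h]
      simpa using this
    · nlinarith [hf _ h, sq_nonneg (v none)]
  rw [Fintype.card_option] at this
  unfold negInertia
  convert Nat.lt_of_succ_le this

/-- A chord of a cycle cuts off a shorter cycle. -/
lemma SimpleGraph.Walk.IsCycle.girth_lt_of_adj_getVert {V : Type*} {G : SimpleGraph V} {a : V}
    {c : G.Walk a a} (hc : c.IsCycle) {i j : ℕ} (hij : i + 1 < j) (hj : j < c.length)
    (h0 : 0 < i ∨ j + 1 < c.length) (hadj : G.Adj (c.getVert i) (c.getVert j)) :
    G.girth < c.length := by
  have hp : ((c.take j).drop i).IsPath := (hc.isPath_take hj).drop i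
  have hi : (c.take j).getVert i = c.getVert i := by
    rw [take_getVert, min_eq_right (by lia)]
  let p := ((c.take j).drop i).copy hi rfl
  have hpl : p.length = j - i := by
    simp only [p, length_copy, drop_length, take_length]
    lia
  have hcyc : (cons hadj.symm p).IsCycle := by
    have hpP : p.IsPath := by simpa [p] using hp
    refine isCycle_iff_isPath_tail_and_le_length.mpr ⟨by simpa using hpP, ?_⟩
    rw [length_cons, hpl]
    lia
  have := girth_le_length hcyc
  rw [length_cons, hpl] at this
  lia

/-- A shortest cycle is an induced subgraph. -/
lemma SimpleGraph.Walk.IsCycle.adj_getVert_iff {V : Type*} {G : SimpleGraph V} {a : V}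
    {c : G.Walk a a} (hc : c.IsCycle) (hg : G.girth = c.length) (i j : Fin c.length) :
    G.Adj (c.getVert i) (c.getVert j) ↔ (cycleGraph c.length).Adj i j := by
  wlog hij : i ≤ j generalizing i j
  · rw [G.adj_comm, (cycleGraph _).adj_comm, this j i (le_of_not_ge hij)]
  have hi := i.2
  have hj := j.2
  have h3 := hc.three_le_length
  rcases hij.eq_or_lt with rfl | hlt
  · simp
  rw [cycleGraph_adj', Fin.coe_sub_iff_le.mpr hij, Fin.coe_sub_iff_lt.mpr hlt]
  have hlt' : (i : ℕ) < j := hlt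
  constructor
  · intro h
    by_contra hne
    exact (hc.girth_lt_of_adj_getVert (by lia) hj (by lia) h).ne hg
  · rintro (h | h)
    · have h0 : (i : ℕ) = 0 := by lia
      have hl : (j : ℕ) + 1 = c.length := by lia
      have := c.adj_getVert_succ hj
      rw [hl, getVert_length] at this
      rw [h0, getVert_zero]
      exact this.symm
    · have := c.adj_getVert_succ hi
      rwa [show (i : ℕ) + 1 = j by lia] at this


/-- If `C` is a shortest cycle (of length `g`, the girth) in a connected graph `G` and
`n(G) = n(C_g)`, then every vertex of `G` is at distance at most `1` from `V(C)`. -/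
theorem dist_le_one_of_negInertia_eq_cycle {V : Type*} [Fintype V] (G : SimpleGraph V)
    (hG : G.Connected) (g : ℕ) (hgirth : G.girth = g)
    {a : V} (c : G.Walk a a) (hc : c.IsCycle) (hclen : c.length = g)
    (hn : G.negInertia = (SimpleGraph.cycleGraph g).negInertia) :
    ∀ x : V, ∃ y ∈ c.support, G.dist x y ≤ 1 := by
  subst hclen
  intro x
  by_contra! h
  have hxa : x ≠ a := by
    rintro rfl
    simpa using h x c.start_mem_support
  have : Nontrivial V := ⟨x, a, hxa⟩
  obtain ⟨y, hxy⟩ := hG.preconnected.exists_adj_of_nontrivial x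
  refine (SimpleGraph.negInertia_lt_of_adj (fun i : Fin c.length ↦ c.getVert i)
    (hc.adj_getVert_iff hgirth) hxy fun i hi ↦ ?_).ne' hn
  exact (h _ (c.getVert_mem_support i)).ne' (SimpleGraph.dist_eq_one_iff_adj.mpr hi)
end

section
/- For every integer m ≥ 3, the cycle graph C_m on m vertices satisfies: n(C_m) = 2⌊(m−1)/4⌋ + 1 if m is even, and n(C_m) = 2⌈(m−1)/4⌉ if m is odd. -/
open Polynomial in
/-- The negative inertia index can be read off a factorization of the characteristic
polynomial into linear factors. -/
lemma SimpleGraph.negInertia_eq_card_of_charpoly_eq {V ι : Type*} [Fintype V] [DecidableEq V]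
    [Fintype ι] (G : SimpleGraph V) [DecidableRel G.Adj] (f : ι → ℝ)
    (h : (G.adjMatrix ℝ).charpoly = ∏ i, (X - C (f i))) :
    G.negInertia = (Finset.univ.filter fun i => f i < 0).card := by
  classical
  have key : (Finset.univ.val.map (G.adjMatrix_isHermitian).eigenvalues : Multiset ℝ) =
      Finset.univ.val.map f := by
    have h₁ := (G.adjMatrix_isHermitian).roots_charpoly_eq_eigenvalues
    rw [h, Polynomial.roots_prod _ _
      (Finset.prod_ne_zero_iff.mpr fun i _ => X_sub_C_ne_zero _)] at h₁
    simpa using h₁.symm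
  have hcount := congrArg (Multiset.countP (· < 0)) key
  rw [Multiset.countP_map, Multiset.countP_map] at hcount
  have hneg : G.negInertia =
      (Finset.univ.filter fun i => (G.adjMatrix_isHermitian).eigenvalues i < 0).card := by
    rw [SimpleGraph.negInertia, Fintype.card_subtype]
    congr!
  rw [hneg]
  exact hcount

/-- A matrix that becomes diagonal after a change of basis has the characteristic polynomial
of the diagonal matrix. -/
lemma Matrix.charpoly_eq_of_mul_eq_mul {n K : Type*} [Fintype n] [DecidableEq n] [Field K]
    {P A D : Matrix n n K} (hP : P.det ≠ 0) (h : P * A = D * P) : A.charpoly = D.charpoly := by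
  have hu : IsUnit P.det := hP.isUnit
  have hA : A = P⁻¹ * (D * P) := by rw [← h, Matrix.nonsing_inv_mul_cancel_left _ _ hu]
  rw [hA, Matrix.charpoly_mul_comm, Matrix.mul_nonsing_inv_cancel_right _ _ hu]

lemma pow_val_add_one {M : Type*} [Monoid M] {n : ℕ} {w : M} (hw : w ^ (n + 2) = 1)
    (i : Fin (n + 2)) : w ^ (i + 1).val = w ^ i.val * w := by
  rw [Fin.val_add, ← pow_eq_pow_mod _ hw, pow_add]
  simp

open Polynomial in
/-- The eigenvalues of the cycle graph on `n` vertices are the numbers `2 cos (2 π k / n)`. -/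
lemma SimpleGraph.charpoly_adjMatrix_cycleGraph {n : ℕ} (hn : 3 ≤ n) :
    ((SimpleGraph.cycleGraph n).adjMatrix ℝ).charpoly =
      ∏ k : Fin n, (X - C (2 * Real.cos (2 * Real.pi * k.val / n))) := by
  obtain ⟨n, rfl⟩ := Nat.exists_eq_add_of_le' hn
  set ζ : ℂ := Complex.exp (2 * Real.pi * Complex.I / (n + 3 : ℕ)) with hζ
  have hprim : IsPrimitiveRoot ζ (n + 3) := Complex.isPrimitiveRoot_exp (n + 3) (by lia)
  have hmul : Matrix.vandermonde (fun k : Fin (n + 3) => ζ ^ k.val) *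
        (SimpleGraph.cycleGraph (n + 3)).adjMatrix ℂ =
      Matrix.diagonal (fun k : Fin (n + 3) =>
        ((2 * Real.cos (2 * Real.pi * k.val / (n + 3 : ℕ)) : ℝ) : ℂ)) *
        Matrix.vandermonde (fun k : Fin (n + 3) => ζ ^ k.val) := by
    ext k i
    have hw : (ζ ^ k.val) ^ (n + 3) = 1 := by
      rw [← pow_mul, mul_comm, pow_mul, hprim.pow_eq_one, one_pow]
    have hcos : ((2 * Real.cos (2 * Real.pi * k.val / (n + 3 : ℕ)) : ℝ) : ℂ) =
        ζ ^ k.val + (ζ ^ k.val)⁻¹ := by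
      push_cast
      rw [Complex.two_cos, hζ, ← Complex.exp_nat_mul, ← Complex.exp_neg]
      push_cast
      congr 2 <;> ring
    have hne : i - 1 ≠ i + 1 := by
      intro h
      have hcard := SimpleGraph.cycleGraph_degree_three_le (v := i)
      rw [SimpleGraph.cycleGraph_degree_two_le, h] at hcard
      simp at hcard
    have hsucc := pow_val_add_one hw i
    have hpred := pow_val_add_one hw (i - 1)
    rw [sub_add_cancel] at hpred
    have hw₀ : ζ ^ k.val ≠ 0 := pow_ne_zero _ (Complex.exp_ne_zero _)
    rw [SimpleGraph.mul_adjMatrix_apply, SimpleGraph.cycleGraph_neighborFinset,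
      Finset.sum_pair hne, Matrix.diagonal_mul, hcos]
    simp only [Matrix.vandermonde_apply]
    rw [hsucc, hpred]
    field_simp
    ring
  have hdet : (Matrix.vandermonde (fun k : Fin (n + 3) => ζ ^ k.val)).det ≠ 0 :=
    Matrix.det_vandermonde_ne_zero_iff.mpr fun a b hab =>
      Fin.ext (hprim.pow_inj a.isLt b.isLt hab)
  have hchar := Matrix.charpoly_eq_of_mul_eq_mul hdet hmul
  have hmap : ((SimpleGraph.cycleGraph (n + 3)).adjMatrix ℝ).map Complex.ofRealHom =
      (SimpleGraph.cycleGraph (n + 3)).adjMatrix ℂ := by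
    ext i j
    simp [SimpleGraph.adjMatrix_apply, apply_ite]
  apply Polynomial.map_injective Complex.ofRealHom Complex.ofReal_injective
  rw [← Matrix.charpoly_map, hmap, hchar, Matrix.charpoly_diagonal, Polynomial.map_prod]
  simp

lemma Real.cos_two_pi_mul_div_neg_iff {n k : ℕ} (hk : k < n) :
    Real.cos (2 * Real.pi * k / n) < 0 ↔ n < 4 * k ∧ 4 * k < 3 * n := by
  have hn : (0 : ℝ) < n := by exact_mod_cast (Nat.zero_le k).trans_lt hk
  have hkn : (k : ℝ) < n := by exact_mod_cast hk
  have hpi := Real.pi_pos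
  have hx : 2 * Real.pi * k / n * n = 2 * Real.pi * k := by field_simp
  set x := 2 * Real.pi * k / n
  constructor
  · intro h
    by_contra hcon
    rcases not_and_or.mp hcon with h' | h'
    · have h' : 4 * (k : ℝ) ≤ n := by exact_mod_cast not_lt.mp h'
      have hx₀ : 0 ≤ x := by positivity
      have hx₁ : x ≤ Real.pi / 2 := by
        refine le_of_mul_le_mul_right ?_ hn
        nlinarith
      exact h.not_ge (Real.cos_nonneg_of_mem_Icc ⟨by linarith, hx₁⟩)
    · have h' : 3 * (n : ℝ) ≤ 4 * k := by exact_mod_cast not_lt.mp h'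
      have hx₀ : 3 * Real.pi / 2 ≤ x := by
        refine le_of_mul_le_mul_right ?_ hn
        nlinarith
      have hx₁ : x ≤ 2 * Real.pi := by
        refine le_of_mul_le_mul_right ?_ hn
        nlinarith
      rw [← Real.cos_sub_two_pi] at h
      exact h.not_ge (Real.cos_nonneg_of_mem_Icc ⟨by linarith, by linarith⟩)
  · rintro ⟨h₁, h₂⟩
    have h₁ : (n : ℝ) < 4 * k := by exact_mod_cast h₁
    have h₂ : 4 * (k : ℝ) < 3 * n := by exact_mod_cast h₂
    apply Real.cos_neg_of_pi_div_two_lt_of_lt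
    · refine lt_of_mul_lt_mul_right ?_ hn.le
      nlinarith
    · refine lt_of_mul_lt_mul_right ?_ hn.le
      nlinarith

/-- The number of negative eigenvalues of a cycle graph, without a parity distinction. -/
lemma SimpleGraph.negInertia_cycleGraph_eq {n : ℕ} (hn : 3 ≤ n) :
    (SimpleGraph.cycleGraph n).negInertia = (3 * n + 3) / 4 - (n / 4 + 1) := by
  rw [SimpleGraph.negInertia_eq_card_of_charpoly_eq _ _
    (SimpleGraph.charpoly_adjMatrix_cycleGraph hn), ← Nat.card_Ico]
  refine Finset.card_bij (fun k _ => k.val) ?_ (fun a _ b _ h => Fin.ext h) ?_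
  · intro k hk
    have hneg : Real.cos (2 * Real.pi * k.val / n) < 0 := by
      have := (Finset.mem_filter.mp hk).2
      linarith
    have := (Real.cos_two_pi_mul_div_neg_iff k.isLt).mp hneg
    rw [Finset.mem_Ico]
    lia
  · intro k hk
    rw [Finset.mem_Ico] at hk
    have hkn : k < n := by lia
    have hneg := (Real.cos_two_pi_mul_div_neg_iff hkn).mpr (by lia)
    refine ⟨⟨k, hkn⟩, Finset.mem_filter.mpr ⟨Finset.mem_univ _, ?_⟩, rfl⟩
    dsimp only
    linarith

/-- For `m ≥ 3`, the cycle `C_m` satisfies `n(C_m) = 2⌊(m−1)/4⌋ + 1` for even `m`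
and `n(C_m) = 2⌈(m−1)/4⌉` for odd `m`. -/
theorem negInertia_cycleGraph (m : ℕ) (hm : 3 ≤ m) :
    (Even m → (SimpleGraph.cycleGraph m).negInertia = 2 * ((m - 1) / 4) + 1) ∧
    (Odd m → (SimpleGraph.cycleGraph m).negInertia = 2 * ((m - 1 + 3) / 4)) := by
  rw [SimpleGraph.negInertia_cycleGraph_eq hm]
  constructor
  · rintro ⟨r, hr⟩
    lia
  · rintro ⟨r, hr⟩
    lia
end

section
/- Let G be a finite connected simple graph containing a cycle, with girth g. Then n(G) ≥ ⌈g/2⌉ − 1. -/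
open Matrix in
/-- If a Hermitian matrix `A` is negative definite on the range of an `n × m` matrix `S`, then `A`
has at least `card m` negative eigenvalues. -/
lemma Matrix.IsHermitian.card_le_card_eigenvalues_neg {n m : Type*} [Fintype n] [DecidableEq n]
    [Fintype m] {A : Matrix n n ℝ} (hA : A.IsHermitian) (S : Matrix n m ℝ)
    (hS : ∀ x : m → ℝ, x ≠ 0 → x ⬝ᵥ (Sᵀ * A * S) *ᵥ x < 0)
    [Fintype {i // hA.eigenvalues i < 0}] :
    Fintype.card m ≤ Fintype.card {i // hA.eigenvalues i < 0} := by
  set U : Matrix n n ℝ := (hA.eigenvectorUnitary : Matrix n n ℝ) with hU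
  have hspec : A = U * diagonal hA.eigenvalues * Uᵀ := by
    have h := hA.spectral_theorem
    rw [Unitary.conjStarAlgAut_apply] at h
    simpa [star_eq_conjTranspose, conjTranspose_eq_transpose_of_trivial] using h
  let L : (m → ℝ) →ₗ[ℝ] ({i // hA.eigenvalues i < 0} → ℝ) :=
    LinearMap.funLeft ℝ ℝ Subtype.val ∘ₗ (Uᵀ * S).mulVecLin
  have hL : Function.Injective L := by
    rw [← LinearMap.ker_eq_bot, LinearMap.ker_eq_bot']
    intro x hx
    by_contra hx0
    refine (hS x hx0).not_ge ?_
    have hform : x ⬝ᵥ (Sᵀ * A * S) *ᵥ x =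
        ∑ i, hA.eigenvalues i * ((Uᵀ * S) *ᵥ x) i ^ 2 := by
      have hconj : Sᵀ * A * S = (Uᵀ * S)ᵀ * (diagonal hA.eigenvalues * (Uᵀ * S)) := by
        conv_lhs => rw [hspec]
        simp [transpose_mul, Matrix.mul_assoc]
      rw [hconj, ← mulVec_mulVec, ← mulVec_mulVec, dotProduct_mulVec, vecMul_transpose]
      simp only [dotProduct, mulVec_diagonal]
      exact Finset.sum_congr rfl fun i _ => by ring
    rw [hform]
    refine Finset.sum_nonneg fun i _ => ?_
    by_cases hi : hA.eigenvalues i < 0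
    · have h0 : ((Uᵀ * S) *ᵥ x) i = 0 := congrFun hx ⟨i, hi⟩
      simp [h0]
    · exact mul_nonneg (not_lt.mp hi) (sq_nonneg _)
  simpa using LinearMap.finrank_le_finrank_of_injective hL

/-- Two vertices of a path that is too short to be closed up to a cycle are adjacent only if they
are consecutive on the path. -/
lemma SimpleGraph.Walk.IsPath.adj_getVert_iff {V : Type*} {G : SimpleGraph V} {u v : V}
    {p : G.Walk u v} (hp : p.IsPath) (hlen : p.length + 1 < G.girth) {i j : ℕ}
    (hi : i ≤ p.length) (hj : j ≤ p.length) :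
    G.Adj (p.getVert i) (p.getVert j) ↔ j = i + 1 ∨ i = j + 1 := by
  have key : ∀ {i j : ℕ}, i ≤ j → j ≤ p.length → G.Adj (p.getVert i) (p.getVert j) →
      j = i + 1 := by
    intro i j hij hj h
    have hq : ((p.take j).drop i).IsPath := (hp.take j).drop i
    have hql : ((p.take j).drop i).length = j - i := by
      simp [SimpleGraph.Walk.drop_length, SimpleGraph.Walk.take_length, hj]
    have h' : G.Adj (p.getVert j) ((p.take j).getVert i) := by
      rw [SimpleGraph.Walk.take_getVert, min_eq_right hij]
      exact h.symm
    have hmem : s(p.getVert j, (p.take j).getVert i) ∈ ((p.take j).drop i).edges := by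
      by_contra hmem
      have := SimpleGraph.girth_le_length
        ((SimpleGraph.Walk.cons_isCycle_iff _ h').mpr ⟨hq, hmem⟩)
      rw [SimpleGraph.Walk.length_cons] at this
      omega
    have := hq.length_eq_one_of_mem_edges (Sym2.eq_swap ▸ hmem)
    omega
  constructor
  · intro h
    rcases le_total i j with hij | hij
    · exact .inl (key hij hj h)
    · exact .inr (key hij hi h.symm)
  · rintro (rfl | rfl)
    · exact p.adj_getVert_succ (by omega)
    · exact (p.adj_getVert_succ (by omega)).symm

/-- The tridiagonal quadratic form with diagonal entries `-2` and off-diagonal entries `-1`, as a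
negative sum of squares. -/
lemma sum_tridiagonal_eq_neg_sum_sq (x : ℕ → ℝ) (k : ℕ) :
    ∑ i ∈ Finset.range (k + 1), ∑ j ∈ Finset.range (k + 1),
      x i * ((if i = j then -2 else if j = i + 1 ∨ i = j + 1 then -1 else 0) * x j) =
    -(x 0 ^ 2 + ∑ i ∈ Finset.range k, (x i + x (i + 1)) ^ 2 + x k ^ 2) := by
  induction k with
  | zero => simp; ring
  | succ k ih =>
    have hcol : ∑ i ∈ Finset.range (k + 1), x i * ((if i = k + 1 then -2 else
        if k + 1 = i + 1 ∨ i = k + 1 + 1 then -1 else 0) * x (k + 1)) = - (x k * x (k + 1)) := by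
      rw [Finset.sum_eq_single_of_mem k (by simp)]
      · simp
      · intro i hi hik
        rw [Finset.mem_range] at hi
        rw [if_neg (by omega), if_neg (by omega)]
        ring
    have hrow : ∑ j ∈ Finset.range (k + 1), x (k + 1) * ((if k + 1 = j then -2 else
        if j = k + 1 + 1 ∨ k + 1 = j + 1 then -1 else 0) * x j) = - (x k * x (k + 1)) := by
      rw [Finset.sum_eq_single_of_mem k (by simp)]
      · simp; ring
      · intro i hi hik
        rw [Finset.mem_range] at hi
        rw [if_neg (by omega), if_neg (by omega)]
        ring
    rw [Finset.sum_range_succ]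
    simp_rw [Finset.sum_range_succ _ (k + 1)]
    rw [Finset.sum_add_distrib, ih, hcol, hrow, Finset.sum_range_succ]
    simp only [if_true]
    ring

open Matrix in
/-- The tridiagonal matrix with diagonal entries `-2` and off-diagonal entries `-1` is negative
definite. -/
lemma tridiagonal_dotProduct_mulVec_neg {k : ℕ} (x : Fin k → ℝ) (hx : x ≠ 0) :
    x ⬝ᵥ (Matrix.of fun i j : Fin k => if i = j then (-2 : ℝ) else
      if (j : ℕ) = i + 1 ∨ (i : ℕ) = j + 1 then -1 else 0) *ᵥ x < 0 := by
  obtain _ | k := k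
  · exact absurd (Subsingleton.elim x 0) hx
  let y : ℕ → ℝ := fun i => if h : i < k + 1 then x ⟨i, h⟩ else 0
  have hy (i : Fin (k + 1)) : y i = x i := dif_pos i.isLt
  have hform : x ⬝ᵥ (Matrix.of fun i j : Fin (k + 1) => if i = j then (-2 : ℝ) else
      if (j : ℕ) = i + 1 ∨ (i : ℕ) = j + 1 then -1 else 0) *ᵥ x =
      -(y 0 ^ 2 + ∑ i ∈ Finset.range k, (y i + y (i + 1)) ^ 2 + y k ^ 2) := by
    rw [← sum_tridiagonal_eq_neg_sum_sq y k]
    simp only [Finset.sum_range, hy, ← Fin.ext_iff, dotProduct, mulVec, Finset.mul_sum,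
      Matrix.of_apply]
  rw [hform, neg_lt_zero]
  have hsum_nonneg : 0 ≤ ∑ i ∈ Finset.range k, (y i + y (i + 1)) ^ 2 :=
    Finset.sum_nonneg fun i _ => sq_nonneg _
  by_contra! hle
  have hy0 : y 0 = 0 := by nlinarith [sq_nonneg (y 0), sq_nonneg (y k)]
  have hsum : ∑ i ∈ Finset.range k, (y i + y (i + 1)) ^ 2 = 0 := by
    nlinarith [sq_nonneg (y 0), sq_nonneg (y k)]
  rw [Finset.sum_eq_zero_iff_of_nonneg fun i _ => sq_nonneg _] at hsum
  have hzero : ∀ i ≤ k, y i = 0 := by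
    intro i
    induction i with
    | zero => exact fun _ => hy0
    | succ i ih =>
      intro hi
      have h := pow_eq_zero_iff two_ne_zero |>.mp (hsum i (Finset.mem_range.mpr hi))
      rwa [ih (by omega), zero_add] at h
  exact hx (funext fun i => (hy i).symm.trans (hzero i (by omega)))

/-- A path with at least `2 * k` vertices that is too short to be closed up to a cycle forces `k`
negative eigenvalues. -/
lemma SimpleGraph.Walk.IsPath.le_negInertia {V : Type*} [Fintype V] {G : SimpleGraph V} {u v : V}
    {p : G.Walk u v} (hp : p.IsPath) (hlen : p.length + 1 < G.girth) {k : ℕ}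
    (hk : 2 * k ≤ p.length + 1) : k ≤ G.negInertia := by
  classical
  let S : Matrix V (Fin k) ℝ := Matrix.of fun w i =>
    (Pi.single (p.getVert (2 * i)) 1 - Pi.single (p.getVert (2 * i + 1)) 1 : V → ℝ) w
  have hS : S.transpose * G.adjMatrix ℝ * S = Matrix.of fun i j : Fin k =>
      if i = j then (-2 : ℝ) else if (j : ℕ) = i + 1 ∨ (i : ℕ) = j + 1 then -1 else 0 := by
    ext i j
    have hentry : (S.transpose * G.adjMatrix ℝ * S) i j =
        dotProduct (fun w => S w i) ((G.adjMatrix ℝ).mulVec fun w => S w j) := by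
      rw [Matrix.mul_assoc]
      rfl
    have hcol (i : Fin k) : (fun w => S w i) =
        Pi.single (p.getVert (2 * i)) 1 - Pi.single (p.getVert (2 * i + 1)) 1 := rfl
    rw [hentry, hcol, hcol]
    simp only [Matrix.mulVec_sub, sub_dotProduct, dotProduct_sub, single_dotProduct,
      Matrix.mulVec_single_one, Matrix.col_apply, SimpleGraph.adjMatrix_apply, one_mul]
    have hi := i.isLt
    have hj := j.isLt
    rw [hp.adj_getVert_iff hlen (by omega) (by omega), hp.adj_getVert_iff hlen (by omega) (by omega),
      hp.adj_getVert_iff hlen (by omega) (by omega), hp.adj_getVert_iff hlen (by omega) (by omega)]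
    simp only [Matrix.of_apply, Fin.ext_iff]
    split_ifs <;> first | omega | norm_num
  have hcard := (G.adjMatrix_isHermitian).card_le_card_eigenvalues_neg S fun x hx => by
    rw [hS]
    exact tridiagonal_dotProduct_mulVec_neg x hx
  rw [Fintype.card_fin] at hcard
  unfold SimpleGraph.negInertia
  convert hcard

/-- If `G` is connected, contains a cycle, and has girth `g`, then `n(G) ≥ ⌈g/2⌉ − 1`. -/
theorem negInertia_ge_half_girth_sub_one {V : Type*} [Fintype V] (G : SimpleGraph V)
    (hG : G.Connected) (hcyc : ¬ G.IsAcyclic) (g : ℕ) (hgirth : G.girth = g) :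
    (g + 1) / 2 - 1 ≤ G.negInertia := by
  obtain ⟨a, c, hc, hlen⟩ := SimpleGraph.exists_girth_eq_length.mpr hcyc
  have h3 := hc.three_le_length
  have hp : (c.take (c.length - 2)).IsPath := hc.isPath_take (by omega)
  have hpl : (c.take (c.length - 2)).length = c.length - 2 := by
    rw [SimpleGraph.Walk.take_length]
    omega
  exact hp.le_negInertia (by omega) (by omega)
end

section
/- Let G be a finite connected simple graph containing a cycle, with girth g. Then n(G) = ⌈g/2⌉ − 1 if and only if either G is isomorphic to a cycle C_m with m ≡ 0 or 1 (mod 4), or G is isomorphic to a complete bipartite graph K_{s,t} with s, t ≥ 2 and s + t ≥ 5. -/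
/-- The quadratic form `x ↦ xᵀ A(G) x` of the adjacency matrix of a graph. -/
noncomputable def SimpleGraph.adjForm {ι : Type*} [Fintype ι] (G : SimpleGraph ι)
    (x : ι → ℝ) : ℝ := by
  classical
  exact ∑ i, ∑ j, if G.Adj i j then x i * x j else 0

namespace SimpleGraph

section

open Matrix

variable {V ι κ : Type*} [Fintype V] [Fintype ι] [Fintype κ]

lemma adjForm_eq (G : SimpleGraph ι) [DecidableRel G.Adj] (x : ι → ℝ) :
    G.adjForm x = ∑ i, ∑ j, if G.Adj i j then x i * x j else 0 := by
  unfold adjForm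
  congr!

lemma adjForm_eq_sum_eigenvalues [DecidableEq V] (G : SimpleGraph V) [DecidableRel G.Adj]
    (x : V → ℝ) :
    G.adjForm ((G.adjMatrix_isHermitian.eigenvectorUnitary : Matrix V V ℝ) *ᵥ x) =
      ∑ i, G.adjMatrix_isHermitian.eigenvalues i * x i ^ 2 := by
  set hA := G.adjMatrix_isHermitian
  set U := (hA.eigenvectorUnitary : Matrix V V ℝ)
  have hform (y : V → ℝ) : G.adjForm y = y ⬝ᵥ (G.adjMatrix ℝ *ᵥ y) := by
    simp only [adjForm, dotProduct, mulVec, adjMatrix_apply, Finset.mul_sum]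
    refine Finset.sum_congr rfl fun i _ ↦ Finset.sum_congr rfl fun j _ ↦ ?_
    split_ifs <;> simp
  have hdiag : Uᵀ * G.adjMatrix ℝ * U = diagonal hA.eigenvalues := by
    have h := hA.conjStarAlgAut_star_eigenvectorUnitary
    rw [Unitary.conjStarAlgAut_star_apply] at h
    simpa [star_eq_conjTranspose, conjTranspose_eq_transpose_of_trivial, Function.comp_def]
      using h
  rw [hform, mulVec_mulVec, dotProduct_comm, ← dotProduct_transpose_mulVec, mulVec_mulVec,
    ← mul_assoc, hdiag, dotProduct_comm]
  simp only [dotProduct, mulVec_diagonal]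
  exact Finset.sum_congr rfl fun i _ ↦ by ring

/-- If the adjacency form is nonnegative on the common kernel of `|κ|` functionals, then the
negative inertia index is at most `|κ|`. -/
lemma negInertia_le_card {H : SimpleGraph ι} {G : SimpleGraph V} (f : H ≃g G)
    (L : (ι → ℝ) →ₗ[ℝ] (κ → ℝ)) (h : ∀ x, L x = 0 → 0 ≤ H.adjForm x) :
    G.negInertia ≤ Fintype.card κ := by
  classical
  have hform (y : V → ℝ) : H.adjForm (y ∘ f) = G.adjForm y := by
    simp only [adjForm, Function.comp_apply]
    refine Fintype.sum_equiv f.toEquiv _ _ fun i ↦ Fintype.sum_equiv f.toEquiv _ _ fun j ↦ ?_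
    simp [f.map_adj_iff]
  set hA := G.adjMatrix_isHermitian
  let E : ({i // hA.eigenvalues i < 0} → ℝ) →ₗ[ℝ] (V → ℝ) :=
    LinearMap.pi fun i ↦ if hi : hA.eigenvalues i < 0 then LinearMap.proj ⟨i, hi⟩ else 0
  let T := L ∘ₗ LinearMap.funLeft ℝ ℝ f ∘ₗ
    (Matrix.mulVecLin (hA.eigenvectorUnitary : Matrix V V ℝ)) ∘ₗ E
  have hT : Function.Injective T := by
    rw [injective_iff_map_eq_zero]
    intro c hc
    have h0 : 0 ≤ ∑ i, hA.eigenvalues i * E c i ^ 2 := by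
      rw [← adjForm_eq_sum_eigenvalues, ← hform]
      exact h _ hc
    have hle : ∀ i ∈ Finset.univ, hA.eigenvalues i * E c i ^ 2 ≤ 0 := by
      intro i _
      by_cases hi : hA.eigenvalues i < 0
      · exact mul_nonpos_of_nonpos_of_nonneg hi.le (sq_nonneg _)
      · simp [E, hi]
    have hz := (Finset.sum_eq_zero_iff_of_nonpos hle).1
      (le_antisymm (Finset.sum_nonpos hle) h0)
    ext ⟨i, hi⟩
    have := hz i (Finset.mem_univ _)
    simpa [E, hi, hi.ne] using this
  have := LinearMap.finrank_le_finrank_of_injective hT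
  simp only [Module.finrank_fintype_fun_eq_card] at this
  simpa only [negInertia] using! this

/-- If the adjacency form of an induced subgraph on `ι` is negative at every nonzero vector of
the common kernel of `|κ|` functionals, then the negative inertia index is at least
`|ι| - |κ|`. -/
lemma card_le_negInertia_add {H : SimpleGraph ι} {G : SimpleGraph V} (f : H ↪g G)
    (L : (ι → ℝ) →ₗ[ℝ] (κ → ℝ)) (h : ∀ x, L x = 0 → 0 ≤ H.adjForm x → x = 0) :
    Fintype.card ι ≤ G.negInertia + Fintype.card κ := by
  classical
  have hform (x : ι → ℝ) : G.adjForm (Function.extend f x 0) = H.adjForm x := by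
    have hsum (F : V → ℝ) (hF : ∀ v ∉ Set.range f, F v = 0) : ∑ v, F v = ∑ i, F (f i) :=
      (Fintype.sum_of_injective f f.injective _ _ hF fun _ ↦ rfl).symm
    simp only [adjForm]
    rw [hsum]
    · refine Finset.sum_congr rfl fun i _ ↦ ?_
      rw [hsum]
      · simp [f.injective.extend_apply, f.map_adj_iff]
      · intro v hv
        simp [Function.extend_apply' x (0 : V → ℝ) v hv]
    · intro v hv
      simp [Function.extend_apply' x (0 : V → ℝ) v hv]
  set hA := G.adjMatrix_isHermitian
  set U := (hA.eigenvectorUnitary : Matrix V V ℝ)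
  let P : (V → ℝ) →ₗ[ℝ] ({i // hA.eigenvalues i < 0} → ℝ) :=
    LinearMap.funLeft ℝ ℝ Subtype.val ∘ₗ Matrix.mulVecLin Uᵀ
  let T := (P ∘ₗ Function.ExtendByZero.linearMap ℝ f).prod L
  have hT : Function.Injective T := by
    rw [injective_iff_map_eq_zero]
    intro x hx
    simp only [T, LinearMap.prod_apply, Function.prod, Prod.mk_eq_zero] at hx
    refine h x hx.2 ?_
    have hUU : U * Uᵀ = 1 := by
      simpa [star_eq_conjTranspose, conjTranspose_eq_transpose_of_trivial] using
        Unitary.coe_mul_star_self hA.eigenvectorUnitary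
    have hy : Function.extend f x 0 = U *ᵥ (Uᵀ *ᵥ Function.extend f x 0) := by
      rw [mulVec_mulVec, hUU, one_mulVec]
    rw [← hform, hy, adjForm_eq_sum_eigenvalues]
    refine Finset.sum_nonneg fun i _ ↦ ?_
    by_cases hi : hA.eigenvalues i < 0
    · have := congrFun hx.1 ⟨i, hi⟩
      have h0 : (Uᵀ *ᵥ Function.extend f x 0) i = 0 := this
      simp [h0]
    · exact mul_nonneg (not_lt.1 hi) (sq_nonneg _)
  have := LinearMap.finrank_le_finrank_of_injective hT
  simp only [Module.finrank_fintype_fun_eq_card, Module.finrank_prod] at this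
  simpa only [negInertia] using! this

end

section

variable {m : ℕ} [NeZero m]

/-- The periodic sequence of the coordinates of a vector indexed by `Fin m`, as a linear map. -/
def cyclicSeq (m : ℕ) [NeZero m] : (Fin m → ℝ) →ₗ[ℝ] (ℕ → ℝ) :=
  LinearMap.funLeft ℝ ℝ (Fin.ofNat m)

lemma cyclicSeq_self (x : Fin m → ℝ) : cyclicSeq m x m = cyclicSeq m x 0 := by
  simp [cyclicSeq, LinearMap.funLeft_apply, Fin.ofNat]

lemma eq_zero_of_cyclicSeq {x : Fin m → ℝ} (h : ∀ i < m, cyclicSeq m x i = 0) : x = 0 := by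
  ext i
  simpa [cyclicSeq, LinearMap.funLeft_apply] using h i i.2

lemma cycleGraph_adj_iff_mod (hm : 2 ≤ m) (i j : Fin m) :
    (cycleGraph m).Adj i j ↔ j = Fin.ofNat m (i + 1) ∨ i = Fin.ofNat m (j + 1) := by
  obtain ⟨n, rfl⟩ := Nat.exists_eq_add_of_le' hm
  have h1 (k : Fin (n + 2)) : Fin.ofNat (n + 2) (k + 1) = k + 1 := by
    ext
    simp [Fin.val_add]
  rw [cycleGraph_adj, h1, h1, sub_eq_iff_eq_add, sub_eq_iff_eq_add, add_comm 1 j, add_comm 1 i,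
    or_comm]

lemma adjForm_cycleGraph (hm : 3 ≤ m) (x : Fin m → ℝ) :
    (cycleGraph m).adjForm x =
      2 * ∑ i ∈ Finset.range m, cyclicSeq m x i * cyclicSeq m x (i + 1) := by
  classical
  have hdisj (i j : Fin m) (h : j = Fin.ofNat m (i + 1)) : i ≠ Fin.ofNat m (j + 1) := by
    rintro h'
    have h1 := congrArg Fin.val h
    have h2 := congrArg Fin.val h'
    simp only [Fin.val_ofNat] at h1 h2
    have := i.2
    rcases Nat.lt_or_ge (i + 1) m with hi | hi
    · rw [Nat.mod_eq_of_lt hi] at h1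
      rcases Nat.lt_or_ge (j + 1) m with hj | hj
      · rw [Nat.mod_eq_of_lt hj] at h2; omega
      · have : (j : ℕ) + 1 = m := by omega
        rw [this, Nat.mod_self] at h2; omega
    · have : (i : ℕ) + 1 = m := by omega
      rw [this, Nat.mod_self] at h1
      rw [h1, Nat.mod_eq_of_lt (by omega)] at h2; omega
  have hsplit (i j : Fin m) : (if (cycleGraph m).Adj i j then x i * x j else 0) =
      (if j = Fin.ofNat m (i + 1) then x i * x j else 0) +
        if i = Fin.ofNat m (j + 1) then x i * x j else 0 := by
    simp only [cycleGraph_adj_iff_mod (show 2 ≤ m by omega)]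
    by_cases h : j = Fin.ofNat m (i + 1)
    · simp only [h, true_or, if_true, if_neg (h ▸ hdisj i j h), add_zero]
    · simp only [h, false_or, if_false, zero_add]
  have hsum : ∑ i ∈ Finset.range m, cyclicSeq m x i * cyclicSeq m x (i + 1) =
      ∑ i : Fin m, x i * x (Fin.ofNat m (i + 1)) := by
    rw [Finset.sum_range]
    simp [cyclicSeq, LinearMap.funLeft_apply]
  rw [adjForm_eq]
  simp only [hsplit, Finset.sum_add_distrib]
  rw [Finset.sum_comm (f := fun i j : Fin m ↦ if i = Fin.ofNat m (j + 1) then x i * x j else 0),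
    hsum, two_mul]
  simp only [Finset.sum_ite_eq', Finset.mem_univ, if_true]
  congr 1
  exact Finset.sum_congr rfl fun i _ ↦ mul_comm _ _

/-- The `i`-th entry of a sequence, as a linear functional. -/
abbrev entry (i : ℕ) : (ℕ → ℝ) →ₗ[ℝ] ℝ :=
  LinearMap.proj i

/-- The odd factors of the splitting of a chain sum into products. -/
def chainOdd (t : ℕ) : (ℕ → ℝ) →ₗ[ℝ] ℝ :=
  entry (2 * t + 1) + entry (2 * t + 3)

/-- The even factors of the splitting of a chain sum into products. -/
def chainEven (t : ℕ) : (ℕ → ℝ) →ₗ[ℝ] ℝ :=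
  entry (2 * t + 2) + (-1 : ℝ) ^ t • entry 0

lemma sum_mul_succ_eq (X : ℕ → ℝ) (j : ℕ) :
    ∑ i ∈ Finset.range (2 * j + 1), X i * X (i + 1) =
      ∑ t ∈ Finset.range j, chainOdd t X * chainEven t X + (-1) ^ j * X 0 * X (2 * j + 1) := by
  induction j with
  | zero => simp
  | succ j ih =>
    rw [show 2 * (j + 1) + 1 = 2 * j + 1 + 1 + 1 by ring, Finset.sum_range_succ,
      Finset.sum_range_succ, ih, Finset.sum_range_succ]
    simp only [chainOdd, chainEven, LinearMap.add_apply, LinearMap.smul_apply,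
      LinearMap.proj_apply, smul_eq_mul]
    ring

/-- The functionals whose vanishing makes all products of the chain splitting nonpositive. -/
def chainMap (j : ℕ) : (ℕ → ℝ) →ₗ[ℝ] (Fin j → ℝ) :=
  LinearMap.pi fun t ↦ chainOdd t + chainEven t

lemma sum_chain_eq_of_chainMap_eq_zero {X : ℕ → ℝ} {j : ℕ} (h : chainMap j X = 0) :
    ∑ t ∈ Finset.range j, chainOdd t X * chainEven t X =
      - ∑ t ∈ Finset.range j, chainOdd t X ^ 2 := by
  rw [← Finset.sum_neg_distrib]
  refine Finset.sum_congr rfl fun t ht ↦ ?_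
  have := congrFun h ⟨t, Finset.mem_range.1 ht⟩
  have h' : chainOdd t X + chainEven t X = 0 := this
  rw [eq_neg_of_add_eq_zero_right h']
  ring

/-- A sequence vanishes up to `2 j + 1` as soon as all factors of the chain splitting, the initial
entry, and one further entry of odd index vanish. -/
lemma eq_zero_of_chain {X : ℕ → ℝ} {j : ℕ} (h : chainMap j X = 0)
    (hs : ∑ t ∈ Finset.range j, chainOdd t X ^ 2 ≤ 0) (h0 : X 0 = 0)
    (h1 : X 1 = 0 ∨ X (2 * j + 1) = 0) : ∀ i ≤ 2 * j + 1, X i = 0 := by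
  have hodd : ∀ t < j, chainOdd t X = 0 := fun t ht ↦ by
    have := (Finset.sum_eq_zero_iff_of_nonneg fun t _ ↦ sq_nonneg (chainOdd t X)).1
      (le_antisymm hs (Finset.sum_nonneg fun t _ ↦ sq_nonneg _)) t (Finset.mem_range.2 ht)
    exact pow_eq_zero_iff two_ne_zero |>.1 this
  have heven : ∀ t < j, X (2 * t + 2) = 0 := fun t ht ↦ by
    have h' : chainOdd t X + chainEven t X = 0 := congrFun h ⟨t, ht⟩
    rw [hodd t ht, zero_add] at h'
    simpa [chainEven, h0] using h'
  have hstep : ∀ t < j, X (2 * t + 3) = -X (2 * t + 1) := fun t ht ↦ by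
    have := hodd t ht
    simp only [chainOdd, LinearMap.add_apply, LinearMap.proj_apply] at this
    linarith
  have habs : ∀ t ≤ j, |X (2 * t + 1)| = |X 1| := by
    intro t
    induction t with
    | zero => simp
    | succ t ih =>
      intro ht
      rw [show 2 * (t + 1) + 1 = 2 * t + 3 by ring, hstep t (by omega), abs_neg, ih (by omega)]
  have h1' : X 1 = 0 := by
    rcases h1 with h1 | h1
    · exact h1
    · have := habs j le_rfl
      rw [h1, abs_zero] at this
      exact abs_eq_zero.1 this.symm
  intro i hi
  rcases Nat.even_or_odd' i with ⟨t, rfl | rfl⟩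
  · rcases t with _ | t
    · exact h0
    · exact heven t (by omega)
  · have := habs t (by omega)
    rwa [h1', abs_zero, abs_eq_zero] at this

end

section

variable {V : Type*} [Fintype V] {G : SimpleGraph V} {m : ℕ} [NeZero m]

lemma negInertia_le_of_iso_cycleGraph (f : cycleGraph m ≃g G) (hm : 3 ≤ m)
    (h4 : m % 4 = 0 ∨ m % 4 = 1) : G.negInertia ≤ (m + 1) / 2 - 1 := by
  obtain ⟨j, hj⟩ : ∃ j, j = (m + 1) / 2 - 1 := ⟨_, rfl⟩
  rw [← hj, ← Fintype.card_fin j]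
  refine negInertia_le_card f
    (LinearMap.pi (fun t : Fin j ↦ chainOdd t - chainEven t) ∘ₗ cyclicSeq m) fun x hx ↦ ?_
  have hX := cyclicSeq_self x
  have hsq : 0 ≤ ∑ t ∈ Finset.range j,
      chainOdd t (cyclicSeq m x) * chainEven t (cyclicSeq m x) := by
    refine Finset.sum_nonneg fun t ht ↦ ?_
    have h : chainOdd t (cyclicSeq m x) - chainEven t (cyclicSeq m x) = 0 :=
      congrFun hx ⟨t, Finset.mem_range.1 ht⟩
    rw [sub_eq_zero.1 h]
    exact mul_self_nonneg _
  rw [adjForm_cycleGraph hm]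
  rcases h4 with h4 | h4
  · have hmj : m = 2 * j + 1 + 1 := by omega
    have hodd : Odd j := by rw [Nat.odd_iff]; omega
    have hs := sum_mul_succ_eq (cyclicSeq m x) j
    rw [hodd.neg_one_pow] at hs
    have : ∑ i ∈ Finset.range m, cyclicSeq m x i * cyclicSeq m x (i + 1) =
        ∑ t ∈ Finset.range j, chainOdd t (cyclicSeq m x) * chainEven t (cyclicSeq m x) := by
      simp only [show Finset.range m = Finset.range (2 * j + 1 + 1) by rw [← hmj]]
      rw [Finset.sum_range_succ, hs, ← hmj, hX]
      ring
    linarith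
  · have hmj : m = 2 * j + 1 := by omega
    have heven : Even j := by rw [Nat.even_iff]; omega
    have hs := sum_mul_succ_eq (cyclicSeq m x) j
    rw [heven.neg_one_pow, ← hmj, hX] at hs
    nlinarith [mul_self_nonneg (cyclicSeq m x 0)]

lemma half_le_negInertia_of_cycleGraph (f : cycleGraph m ↪g G) (hm : 3 ≤ m)
    (h4 : m % 4 = 2 ∨ m % 4 = 3) : (m + 1) / 2 ≤ G.negInertia := by
  rcases h4 with h4 | h4
  · obtain ⟨j, hmj⟩ : ∃ j, m = 2 * j + 1 + 1 := ⟨m / 2 - 1, by omega⟩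
    have heven : Even j := by rw [Nat.even_iff]; omega
    have := card_le_negInertia_add f (LinearMap.pi (Sum.elim
        (fun t : Fin j ↦ chainOdd t + chainEven t) ![entry (2 * j + 1) + entry 0]) ∘ₗ cyclicSeq m)
      fun x hx hq ↦ ?_
    · simp only [Fintype.card_fin, Fintype.card_sum] at this
      omega
    have hX := cyclicSeq_self x
    have hc : chainMap j (cyclicSeq m x) = 0 := funext fun t ↦ congrFun hx (Sum.inl t)
    have hl : cyclicSeq m x (2 * j + 1) + cyclicSeq m x 0 = 0 := congrFun hx (Sum.inr 0)
    have hs := sum_mul_succ_eq (cyclicSeq m x) j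
    rw [adjForm_cycleGraph hm] at hq
    simp only [show Finset.range m = Finset.range (2 * j + 1 + 1) by rw [← hmj]] at hq
    rw [Finset.sum_range_succ, hs, heven.neg_one_pow, ← hmj, hX,
      sum_chain_eq_of_chainMap_eq_zero hc, eq_neg_of_add_eq_zero_left hl] at hq
    have hnn : 0 ≤ ∑ t ∈ Finset.range j, chainOdd t (cyclicSeq m x) ^ 2 :=
      Finset.sum_nonneg fun t _ ↦ sq_nonneg _
    have h0 : cyclicSeq m x 0 = 0 := by
      by_contra h
      nlinarith [sq_pos_of_ne_zero h]
    refine eq_zero_of_cyclicSeq fun i hi ↦ eq_zero_of_chain hc ?_ h0 (Or.inr ?_) i (by omega)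
    · rw [h0] at hq
      linarith
    · linarith
  · obtain ⟨j, hmj⟩ : ∃ j, m = 2 * j + 1 := ⟨m / 2, by omega⟩
    have hodd : Odd j := by rw [Nat.odd_iff]; omega
    have := card_le_negInertia_add f (chainMap j ∘ₗ cyclicSeq m) fun x hc hq ↦ ?_
    · simp only [Fintype.card_fin] at this
      omega
    have hX := cyclicSeq_self x
    replace hc : chainMap j (cyclicSeq m x) = 0 := hc
    have hs := sum_mul_succ_eq (cyclicSeq m x) j
    rw [← hmj, hX, hodd.neg_one_pow, sum_chain_eq_of_chainMap_eq_zero hc] at hs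
    rw [adjForm_cycleGraph hm, hs] at hq
    have hnn : 0 ≤ ∑ t ∈ Finset.range j, chainOdd t (cyclicSeq m x) ^ 2 :=
      Finset.sum_nonneg fun t _ ↦ sq_nonneg _
    have h0 : cyclicSeq m x 0 = 0 := by
      by_contra h
      nlinarith [sq_pos_of_ne_zero h]
    refine eq_zero_of_cyclicSeq fun i hi ↦ eq_zero_of_chain hc ?_ h0 (Or.inr ?_) i (by omega)
    · rw [h0] at hq
      linarith
    · rw [← hmj, hX, h0]

lemma half_sub_one_le_negInertia_of_cycleGraph (f : cycleGraph m ↪g G) (hm : 3 ≤ m) :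
    (m + 1) / 2 - 1 ≤ G.negInertia := by
  obtain ⟨j, hj⟩ : ∃ j, j = (m + 1) / 2 - 1 := ⟨_, rfl⟩
  have := card_le_negInertia_add f (LinearMap.pi (Sum.elim
      (fun t : Fin j ↦ chainOdd t + chainEven t)
      (fun i : Fin (m - 2 * j) ↦ entry i)) ∘ₗ cyclicSeq m) fun x hx hq ↦ ?_
  · simp only [Fintype.card_fin, Fintype.card_sum] at this
    omega
  have hX := cyclicSeq_self x
  have hc : chainMap j (cyclicSeq m x) = 0 := funext fun t ↦ congrFun hx (Sum.inl t)
  have hl : ∀ i < m - 2 * j, cyclicSeq m x i = 0 := fun i hi ↦ congrFun hx (Sum.inr ⟨i, hi⟩)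
  have h0 : cyclicSeq m x 0 = 0 := hl 0 (by omega)
  have hs := sum_mul_succ_eq (cyclicSeq m x) j
  rw [adjForm_cycleGraph hm] at hq
  have hlast : cyclicSeq m x 1 = 0 ∨ cyclicSeq m x (2 * j + 1) = 0 := by
    rcases Nat.even_or_odd' m with ⟨k, hk | hk⟩
    · exact Or.inl (hl 1 (by omega))
    · rw [show 2 * j + 1 = m by omega, hX]
      exact Or.inr h0
  have hsum : ∑ i ∈ Finset.range m, cyclicSeq m x i * cyclicSeq m x (i + 1) =
      ∑ i ∈ Finset.range (2 * j + 1), cyclicSeq m x i * cyclicSeq m x (i + 1) := by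
    rcases Nat.even_or_odd' m with ⟨k, hk | hk⟩
    · have hmj : m = 2 * j + 1 + 1 := by omega
      simp only [show Finset.range m = Finset.range (2 * j + 1 + 1) by rw [← hmj]]
      rw [Finset.sum_range_succ, ← hmj, hX, h0, mul_zero, add_zero]
    · rw [show Finset.range m = Finset.range (2 * j + 1) by congr 1; omega]
  rw [hsum, hs, h0, sum_chain_eq_of_chainMap_eq_zero hc] at hq
  refine eq_zero_of_cyclicSeq fun i hi ↦ eq_zero_of_chain hc ?_ h0 hlast i (by omega)
  linarith

lemma adjForm_option {ι : Type*} [Fintype ι] (H : SimpleGraph (Option ι)) [DecidableRel H.Adj]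
    (x : Option ι → ℝ) :
    H.adjForm x = (H.comap some).adjForm (x ∘ some) +
      2 * (x none * ∑ i, if H.Adj none (some i) then x (some i) else 0) := by
  rw [adjForm_eq, adjForm_eq]
  simp only [Fintype.sum_option, SimpleGraph.irrefl, if_false, zero_add, Finset.sum_add_distrib,
    comap_adj, Function.comp_apply, Finset.mul_sum, H.adj_comm (some _) none]
  rw [← add_assoc, add_comm, ← Finset.sum_add_distrib]
  congr 1
  refine Finset.sum_congr rfl fun i _ ↦ ?_
  split_ifs <;> ring

lemma half_le_negInertia_of_pendant {H : SimpleGraph (Option (Fin m))} (f : H ↪g G)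
    (hcyc : H.comap some = cycleGraph m) (hpend : ∀ i, H.Adj none (some i) ↔ i = 0) (hm : 3 ≤ m)
    (h4 : m % 4 = 0 ∨ m % 4 = 1) : (m + 1) / 2 ≤ G.negInertia := by
  classical
  let R : (Option (Fin m) → ℝ) →ₗ[ℝ] (ℕ → ℝ) := cyclicSeq m ∘ₗ LinearMap.funLeft ℝ ℝ some
  have hform (x : Option (Fin m) → ℝ) : H.adjForm x =
      2 * ∑ i ∈ Finset.range m, R x i * R x (i + 1) + 2 * (x none * R x 0) := by
    rw [adjForm_option, hcyc, adjForm_cycleGraph hm]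
    simp only [hpend, Finset.sum_ite_eq', Finset.mem_univ, if_true]
    rfl
  have hzero (x : Option (Fin m) → ℝ) (hn : x none = 0) (h : ∀ i < m, R x i = 0) : x = 0 := by
    have h0 : LinearMap.funLeft ℝ ℝ some x = 0 := eq_zero_of_cyclicSeq h
    ext i
    rcases i with _ | i
    · exact hn
    · exact congrFun h0 i
  rcases h4 with h4 | h4
  · obtain ⟨j, hmj⟩ : ∃ j, m = 2 * j + 1 + 1 := ⟨m / 2 - 1, by omega⟩
    have hodd : Odd j := by rw [Nat.odd_iff]; omega
    have := card_le_negInertia_add f (LinearMap.pi (Sum.elim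
        (fun t : Fin j ↦ (chainOdd t + chainEven t) ∘ₗ R)
        ![LinearMap.proj none + entry 0 ∘ₗ R, entry 1 ∘ₗ R])) fun x hx hq ↦ ?_
    · simp only [Fintype.card_fin, Fintype.card_sum, Fintype.card_option] at this
      omega
    have hX : R x m = R x 0 := cyclicSeq_self (LinearMap.funLeft ℝ ℝ some x)
    have hc : chainMap j (R x) = 0 := funext fun t ↦ congrFun hx (Sum.inl t)
    have hl : x none + R x 0 = 0 := congrFun hx (Sum.inr 0)
    have h1 : R x 1 = 0 := congrFun hx (Sum.inr 1)
    have hs := sum_mul_succ_eq (R x) j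
    rw [hform] at hq
    simp only [show Finset.range m = Finset.range (2 * j + 1 + 1) by rw [← hmj]] at hq
    rw [Finset.sum_range_succ, hs, hodd.neg_one_pow, ← hmj, hX,
      sum_chain_eq_of_chainMap_eq_zero hc, eq_neg_of_add_eq_zero_left hl] at hq
    have hnn : 0 ≤ ∑ t ∈ Finset.range j, chainOdd t (R x) ^ 2 :=
      Finset.sum_nonneg fun t _ ↦ sq_nonneg _
    have h0 : R x 0 = 0 := by
      by_contra h
      nlinarith [sq_pos_of_ne_zero h]
    refine hzero x (by linarith) fun i hi ↦ eq_zero_of_chain hc ?_ h0 (Or.inl h1) i (by omega)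
    rw [h0] at hq
    linarith
  · obtain ⟨j, hmj⟩ : ∃ j, m = 2 * j + 1 := ⟨m / 2, by omega⟩
    have heven : Even j := by rw [Nat.even_iff]; omega
    have := card_le_negInertia_add f (LinearMap.pi (Sum.elim
        (fun t : Fin j ↦ (chainOdd t + chainEven t) ∘ₗ R)
        ![LinearMap.proj none + (2 : ℝ) • entry 0 ∘ₗ R])) fun x hx hq ↦ ?_
    · simp only [Fintype.card_fin, Fintype.card_sum, Fintype.card_option] at this
      omega
    have hX : R x m = R x 0 := cyclicSeq_self (LinearMap.funLeft ℝ ℝ some x)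
    have hc : chainMap j (R x) = 0 := funext fun t ↦ congrFun hx (Sum.inl t)
    have hl : x none + 2 * R x 0 = 0 := congrFun hx (Sum.inr 0)
    have hs := sum_mul_succ_eq (R x) j
    rw [← hmj, hX, heven.neg_one_pow, sum_chain_eq_of_chainMap_eq_zero hc] at hs
    rw [hform, hs, eq_neg_of_add_eq_zero_left hl] at hq
    have hnn : 0 ≤ ∑ t ∈ Finset.range j, chainOdd t (R x) ^ 2 :=
      Finset.sum_nonneg fun t _ ↦ sq_nonneg _
    have h0 : R x 0 = 0 := by
      by_contra h
      nlinarith [sq_pos_of_ne_zero h]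
    refine hzero x (by linarith) fun i hi ↦ eq_zero_of_chain hc ?_ h0 (Or.inr ?_) i (by omega)
    · rw [h0] at hq
      linarith
    · rw [← hmj, hX, h0]

lemma one_le_negInertia_of_adj {a b : V} (hab : G.Adj a b) : 1 ≤ G.negInertia := by
  classical
  have hinj : Function.Injective ![a, b] := by
    have := hab.ne
    intro i j h
    fin_cases i <;> fin_cases j <;> simp_all
  have := card_le_negInertia_add (Embedding.comap ⟨_, hinj⟩ G)
    (LinearMap.pi ![(LinearMap.proj 0 : (Fin 2 → ℝ) →ₗ[ℝ] ℝ) + LinearMap.proj 1]) fun x hx hq ↦ ?_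
  · simpa using this
  have h01 : x 0 + x 1 = 0 := congrFun hx 0
  simp only [adjForm_eq, Fin.sum_univ_two, comap_adj, Function.Embedding.coeFn_mk,
    Matrix.cons_val_zero, Matrix.cons_val_one, SimpleGraph.irrefl, hab, hab.symm, if_true, if_false] at hq
  have h0 : x 0 = 0 := by nlinarith [sq_nonneg (x 0)]
  ext i
  fin_cases i
  · exact h0
  · simpa [h0] using h01

/-- A graph with an induced path on four vertices has negative inertia index at least two. -/
lemma two_le_negInertia_of_path {a b c d : V} (hab : G.Adj a b) (hbc : G.Adj b c)
    (hcd : G.Adj c d) (hac : ¬ G.Adj a c) (hbd : ¬ G.Adj b d) (had : ¬ G.Adj a d) :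
    2 ≤ G.negInertia := by
  classical
  have hinj : Function.Injective ![a, b, c, d] := by
    have h1 := hab.ne
    have h2 := hbc.ne
    have h3 := hcd.ne
    have h4 : a ≠ c := by rintro rfl; exact had hcd
    have h5 : b ≠ d := by rintro rfl; exact had hab
    have h6 : a ≠ d := by rintro rfl; exact hac hcd.symm
    intro i j h
    fin_cases i <;> fin_cases j <;> simp_all
  have := card_le_negInertia_add (Embedding.comap ⟨_, hinj⟩ G)
    (LinearMap.pi ![(LinearMap.proj 0 : (Fin 4 → ℝ) →ₗ[ℝ] ℝ) + LinearMap.proj 1,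
      (LinearMap.proj 2 : (Fin 4 → ℝ) →ₗ[ℝ] ℝ) + LinearMap.proj 3])
    fun x hx hq ↦ ?_
  · simpa using this
  have h01 : x 0 + x 1 = 0 := congrFun hx 0
  have h23 : x 2 + x 3 = 0 := congrFun hx 1
  have hca := mt Adj.symm hac
  have hdb := mt Adj.symm hbd
  have hda := mt Adj.symm had
  simp [adjForm_eq, Fin.sum_univ_four, comap_adj, hab, hab.symm, hbc, hbc.symm, hcd, hcd.symm,
    hac, hbd, had, hca, hdb, hda] at hq
  rw [eq_neg_of_add_eq_zero_right h01, eq_neg_of_add_eq_zero_right h23] at hq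
  have h0 : x 0 = 0 := by
    by_contra h
    nlinarith [sq_pos_of_ne_zero h, sq_nonneg (x 0 + x 2), sq_nonneg (x 2)]
  have h2 : x 2 = 0 := by
    by_contra h
    nlinarith [sq_pos_of_ne_zero h, sq_nonneg (x 0 + x 2), sq_nonneg (x 0)]
  ext i
  fin_cases i
  · exact h0
  · simpa [h0] using h01
  · exact h2
  · simpa [h2] using h23

lemma negInertia_le_one_of_iso_completeBipartiteGraph {α β : Type*} [Fintype α] [Fintype β]
    (f : completeBipartiteGraph α β ≃g G) : G.negInertia ≤ 1 := by
  classical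
  have := negInertia_le_card f (κ := Unit) (LinearMap.pi fun _ ↦
    (∑ i, LinearMap.proj (Sum.inl i)) - ∑ i, LinearMap.proj (Sum.inr i)) fun x hx ↦ ?_
  · simpa using this
  have h : ∑ i, x (Sum.inl i) - ∑ i, x (Sum.inr i) = 0 := by
    simpa using congrFun hx ()
  have hform : (completeBipartiteGraph α β).adjForm x =
      2 * ((∑ i, x (Sum.inl i)) * ∑ i, x (Sum.inr i)) := by
    rw [adjForm_eq]
    simp only [Fintype.sum_sum_type, completeBipartiteGraph_adj]
    simp only [Sum.isLeft_inl, Sum.isRight_inl, Sum.isLeft_inr, Sum.isRight_inr]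
    simp [← Finset.mul_sum, ← Finset.sum_mul]
    ring
  rw [hform, sub_eq_zero.1 h]
  exact mul_nonneg two_pos.le (mul_self_nonneg _)

end

section

variable {V : Type*} {G : SimpleGraph V} {g : ℕ} {X : ℕ → V}

lemma girth_le_of_closed_seq {k : ℕ} (hk : 2 ≤ k) (hinj : Set.InjOn X (Set.Iic k))
    (hadj : ∀ i < k, G.Adj (X i) (X (i + 1))) (hclose : G.Adj (X k) (X 0)) :
    G.girth ≤ k + 1 := by
  have key (i j : Fin (k + 1)) (h : j = Fin.ofNat (k + 1) (i + 1)) : G.Adj (X i) (X j) := by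
    have h' := congrArg Fin.val h
    rw [Fin.val_ofNat] at h'
    rcases Nat.lt_or_ge i k with hi | hi
    · rw [h', Nat.mod_eq_of_lt (by omega)]
      exact hadj _ hi
    · have hik : (i : ℕ) = k := by omega
      rw [h', hik, Nat.mod_self]
      exact hclose
  have hcopy : cycleGraph (k + 1) ⊑ G := by
    refine ⟨⟨⟨fun i ↦ X i, fun {i j} hij ↦ ?_⟩, fun i j hij ↦ Fin.ext ?_⟩⟩
    · rcases (cycleGraph_adj_iff_mod (by omega) i j).1 hij with h | h
      · exact key i j h
      · exact (key j i h).symm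
    · exact hinj (Nat.lt_succ_iff.1 i.2) (Nat.lt_succ_iff.1 j.2) hij
  obtain ⟨v, p, hp, hl⟩ := (cycleGraph_isContained_iff (by omega)).1 hcopy
  exact hl ▸ girth_le_length hp

/-- A sequence of vertices running periodically around a cycle of length `g`. -/
structure IsCyclicSeq (G : SimpleGraph V) (g : ℕ) (X : ℕ → V) : Prop where
  eq_iff : ∀ i j, X i = X j ↔ i ≡ j [MOD g]
  adj : ∀ i, G.Adj (X i) (X (i + 1))

lemma exists_isCyclicSeq_girth (hG : ¬ G.IsAcyclic) : ∃ X, G.IsCyclicSeq G.girth X := by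
  have h3 := three_le_girth hG
  have hcopy : cycleGraph G.girth ⊑ G := by
    obtain ⟨v, p, hp, hl⟩ := exists_girth_eq_length.2 hG
    exact (cycleGraph_isContained_iff (by omega)).2 ⟨v, p, hp, hl.symm⟩
  obtain ⟨f⟩ := hcopy
  have : NeZero G.girth := ⟨by omega⟩
  refine ⟨fun n ↦ f (Fin.ofNat _ n), fun i j ↦ ?_, fun i ↦ ?_⟩
  · exact (f.injective.eq_iff (a := Fin.ofNat _ i) (b := Fin.ofNat _ j)).trans Fin.ext_iff
  · refine f.toHom.map_adj ((cycleGraph_adj_iff_mod (by omega) _ _).2 (Or.inl ?_))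
    ext
    simp

namespace IsCyclicSeq

lemma shift (h : G.IsCyclicSeq g X) (s : ℕ) : G.IsCyclicSeq g fun n ↦ X (s + n) :=
  ⟨fun _ _ ↦ (h.eq_iff _ _).trans ⟨Nat.ModEq.add_left_cancel' s, Nat.ModEq.add_left s⟩,
    fun i ↦ h.adj (s + i)⟩

lemma apply_self (h : G.IsCyclicSeq g X) : X g = X 0 :=
  (h.eq_iff _ _).2 (by simp [Nat.ModEq])

lemma injOn (h : G.IsCyclicSeq g X) : Set.InjOn X (Set.Iio g) := fun i hi j hj hij ↦
  ((h.eq_iff i j).1 hij).eq_of_lt_of_lt hi hj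

lemma eq_one_or_of_adj_zero (h : G.IsCyclicSeq G.girth X) {d : ℕ} (hd : d < G.girth)
    (hadj : G.Adj (X 0) (X d)) : d = 1 ∨ d + 1 = G.girth := by
  have hd0 : d ≠ 0 := by
    rintro rfl
    exact G.irrefl hadj
  by_contra! hne
  have := girth_le_of_closed_seq (G := G) (X := X) (k := d) (by omega)
    (h.injOn.mono fun i (hi : i ≤ d) ↦ lt_of_le_of_lt hi hd) (fun i _ ↦ h.adj i) hadj.symm
  omega

lemma exists_embedding (h : G.IsCyclicSeq G.girth X) (h3 : 3 ≤ G.girth) :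
    ∃ f : cycleGraph G.girth ↪g G, ∀ i, f i = X i := by
  have : NeZero G.girth := ⟨by omega⟩
  have hback (i j : Fin G.girth) (hij : j = Fin.ofNat _ (i + 1)) : G.Adj (X i) (X j) := by
    have : X j = X (i + 1) := (h.eq_iff _ _).2 (by simp [hij, Nat.ModEq])
    rw [this]
    exact h.adj i
  have hforw (i j : Fin G.girth) (hlt : i < j) (hij : G.Adj (X i) (X j)) :
      j = Fin.ofNat _ (i + 1) ∨ i = Fin.ofNat _ (j + 1) := by
    have hlt' : (i : ℕ) < j := hlt
    have hj := j.2
    rcases (h.shift i).eq_one_or_of_adj_zero (d := j - i) (by omega)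
      (by rwa [add_zero, Nat.add_sub_cancel' hlt'.le]) with hd | hd
    · left
      ext
      rw [Fin.val_ofNat, Nat.mod_eq_of_lt (by omega)]
      omega
    · right
      ext
      rw [Fin.val_ofNat, show (j : ℕ) + 1 = G.girth by omega, Nat.mod_self]
      omega
  refine ⟨⟨⟨fun i ↦ X i, fun i j hij ↦ Fin.ext (h.injOn i.2 j.2 hij)⟩, fun {i j} ↦ ?_⟩,
    fun _ ↦ rfl⟩
  rw [cycleGraph_adj_iff_mod (by omega)]
  refine ⟨fun hij ↦ ?_, ?_⟩
  · rcases lt_trichotomy i j with hlt | rfl | hlt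
    · exact hforw i j hlt hij
    · exact (G.irrefl hij).elim
    · exact (hforw j i hlt hij.symm).symm
  · rintro (hij | hij)
    · exact hback i j hij
    · exact (hback j i hij).symm

lemma girth_le_of_common_neighbor (h : G.IsCyclicSeq g X) {v : V} (hv : ∀ n, v ≠ X n)
    (h0 : G.Adj v (X 0)) {j : ℕ} (hj0 : 0 < j) (hj : j < g) (hvj : G.Adj v (X j)) :
    G.girth ≤ j + 2 := by
  refine girth_le_of_closed_seq (X := fun n ↦ n.casesOn v X) (k := j + 1) (by omega) ?_ ?_ hvj.symm
  · rintro (_ | a) ha (_ | b) hb hab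
    · rfl
    · exact (hv _ hab).elim
    · exact (hv _ hab.symm).elim
    · rw [Set.mem_Iic] at ha hb
      exact congrArg _ (h.injOn (Set.mem_Iio.2 (by omega)) (Set.mem_Iio.2 (by omega)) hab)
  · rintro (_ | a) _
    · exact h0
    · exact h.adj a

lemma half_le_negInertia [Fintype V] (h : G.IsCyclicSeq G.girth X) (h5 : 5 ≤ G.girth)
    (h4 : G.girth % 4 = 0 ∨ G.girth % 4 = 1) {v : V} (hv : ∀ n, v ≠ X n) (h0 : G.Adj v (X 0)) :
    (G.girth + 1) / 2 ≤ G.negInertia := by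
  have : NeZero G.girth := ⟨by omega⟩
  obtain ⟨f, hf⟩ := h.exists_embedding (by omega)
  let F : Option (Fin G.girth) ↪ V := f.toEmbedding.optionElim v (by
    rintro ⟨i, hi⟩
    exact hv i (hi.symm.trans (hf i)))
  refine half_le_negInertia_of_pendant (Embedding.comap F G) ?_ ?_ (by omega) h4
  · ext i j
    exact f.map_adj_iff
  · intro i
    change G.Adj v (f i) ↔ i = 0
    rw [hf]
    refine ⟨fun hi ↦ ?_, fun hi ↦ by simpa [hi] using h0⟩
    by_contra hne
    have hpos : 0 < (i : ℕ) := Nat.pos_of_ne_zero fun h ↦ hne (Fin.ext h)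
    have h1 := h.girth_le_of_common_neighbor hv h0 hpos i.2 hi
    have h2 := (h.shift i).girth_le_of_common_neighbor (fun n ↦ hv _) hi (j := G.girth - i)
      (by omega) (by omega) (by
        rw [Nat.add_sub_cancel' i.2.le, h.apply_self]
        exact h0)
    omega

end IsCyclicSeq

lemma Connected.mem_of_adj_closed (hG : G.Connected) {S : Set V} {a : V} (ha : a ∈ S)
    (hS : ∀ u ∈ S, ∀ v, G.Adj u v → v ∈ S) (v : V) : v ∈ S := by
  obtain ⟨p⟩ := hG.preconnected a v
  induction p with
  | nil => exact ha
  | cons h _ ih => exact ih (hS _ ha _ h)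

/-- In a connected graph, a cyclic sequence missing some vertex can be rotated to start at a
vertex having a neighbour off the cycle. -/
lemma Connected.exists_adj_off_cyclicSeq (hG : G.Connected) {w : V} (hw : ∀ n, w ≠ X n) :
    ∃ s v, (∀ n, v ≠ X n) ∧ G.Adj v (X s) := by
  by_contra! hcon
  obtain ⟨n, hn⟩ := hG.mem_of_adj_closed (S := Set.range X) (Set.mem_range_self 0)
    (fun u hu v huv ↦ by
      obtain ⟨s, rfl⟩ := hu
      by_contra hv
      exact hcon s v (fun n hn ↦ hv ⟨n, hn.symm⟩) huv.symm) w
  exact hw n hn.symm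

lemma Connected.adj_or_adj_of_negInertia_le_one [Fintype V] (hG : G.Connected)
    (htri : ∀ u v w, G.Adj u v → G.Adj v w → ¬ G.Adj u w) (hn : G.negInertia ≤ 1) {a b : V}
    (hab : G.Adj a b) (v : V) : G.Adj a v ∨ G.Adj b v := by
  have key (a b : V) (hab : G.Adj a b) (u v : V) (hau : G.Adj a u) (huv : G.Adj u v) :
      G.Adj a v ∨ G.Adj b v := by
    by_contra! hcon
    rcases eq_or_ne b u with rfl | hbu
    · exact hcon.2 huv
    have := two_le_negInertia_of_path huv.symm hau.symm hab (mt Adj.symm hcon.1)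
      (fun h ↦ htri _ _ _ hau h hab) (mt Adj.symm hcon.2)
    omega
  refine hG.mem_of_adj_closed (S := {v | G.Adj a v ∨ G.Adj b v}) (Or.inl hab) ?_ v
  rintro u (hu | hu) v huv
  · exact key a b hab u v hu huv
  · exact (key b a hab.symm u v hu huv).symm

lemma Connected.adj_iff_of_negInertia_le_one [Fintype V] (hG : G.Connected)
    (htri : ∀ u v w, G.Adj u v → G.Adj v w → ¬ G.Adj u w) (hn : G.negInertia ≤ 1) {a b : V}
    (hab : G.Adj a b) (u v : V) : G.Adj u v ↔ ¬ (G.Adj a u ↔ G.Adj a v) := by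
  have hor := hG.adj_or_adj_of_negInertia_le_one htri hn hab
  have hmix (u v : V) (hu : G.Adj a u) (hv : ¬ G.Adj a v) : G.Adj u v := by
    by_contra huv
    have hbv := (hor v).resolve_left hv
    have := two_le_negInertia_of_path hu.symm hab hbv (fun h ↦ htri _ _ _ hu h hab) hv huv
    omega
  by_cases hu : G.Adj a u <;> by_cases hv : G.Adj a v
  · simpa [hu, hv] using fun h ↦ htri _ _ _ hu h hv
  · simpa [hu, hv] using hmix u v hu hv
  · simpa [hu, hv] using (hmix v u hv hu).symm
  · simpa [hu, hv] using fun h ↦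
      htri _ _ _ ((hor u).resolve_left hu) h ((hor v).resolve_left hv)

lemma nonempty_iso_completeBipartiteGraph [Fintype V] (p : V → Prop) [DecidablePred p]
    (h : ∀ u v, G.Adj u v ↔ ¬ (p u ↔ p v)) :
    Nonempty (G ≃g completeBipartiteGraph (Fin (Fintype.card {v // p v}))
      (Fin (Fintype.card {v // ¬ p v}))) := by
  let e := (Equiv.sumCompl p).symm.trans
    (Equiv.sumCongr (Fintype.equivFin {v // p v}) (Fintype.equivFin {v // ¬ p v}))
  have hleft (v : V) : (e v).isLeft = true ↔ p v := by
    by_cases hv : p v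
    · simp [e, Equiv.sumCompl_symm_apply_of_pos hv, hv]
    · simp [e, Equiv.sumCompl_symm_apply_of_neg hv, hv]
  have hright (v : V) : (e v).isRight = true ↔ ¬ p v := by
    rw [← hleft]
    cases e v <;> simp
  refine ⟨⟨e, fun {u v} ↦ ?_⟩⟩
  rw [completeBipartiteGraph_adj, h, hleft, hright, hleft, hright]
  tauto

lemma girth_of_iso_completeBipartiteGraph {s t : ℕ} (hs : 2 ≤ s) (ht : 2 ≤ t)
    (hG : ¬ G.IsAcyclic) (e : G ≃g completeBipartiteGraph (Fin s) (Fin t)) : G.girth = 4 := by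
  refine le_antisymm ?_ ?_
  · let Y : ℕ → Fin s ⊕ Fin t
      | 0 => Sum.inl ⟨0, by omega⟩
      | 1 => Sum.inr ⟨0, by omega⟩
      | 2 => Sum.inl ⟨1, by omega⟩
      | _ => Sum.inr ⟨1, by omega⟩
    refine girth_le_of_closed_seq (X := fun n ↦ e.symm (Y n)) (k := 3) (by omega) ?_ ?_ ?_
    · intro i hi j hj hij
      have hij' := e.symm.injective hij
      rw [Set.mem_Iic] at hi hj
      interval_cases i <;> interval_cases j <;> simp_all [Y]
    · intro i hi
      rw [e.symm.map_adj_iff]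
      interval_cases i <;> simp [Y]
    · rw [e.symm.map_adj_iff]
      simp [Y]
  · by_contra hlt
    have h3 := three_le_girth hG
    obtain ⟨X, hX⟩ := exists_isCyclicSeq_girth hG
    have h30 : X 3 = X 0 := by
      rw [← hX.apply_self]
      congr 1
      omega
    have h01 := e.map_adj_iff.2 (hX.adj 0)
    have h12 := e.map_adj_iff.2 (hX.adj 1)
    have h20 := e.map_adj_iff.2 (hX.adj 2)
    rw [h30] at h20
    simp only [completeBipartiteGraph_adj, zero_add, Nat.reduceAdd] at h01 h12 h20
    revert h01 h12 h20
    cases e (X 0) <;> cases e (X 1) <;> cases e (X 2) <;> simp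

lemma girth_of_iso_cycleGraph [Fintype V] (hconn : G.Connected) (hG : ¬ G.IsAcyclic) {m : ℕ}
    (hm : 3 ≤ m) (e : G ≃g cycleGraph m) : G.girth = m := by
  classical
  have h3 := three_le_girth hG
  obtain ⟨X, hX⟩ := exists_isCyclicSeq_girth hG
  obtain ⟨f, hf⟩ := hX.exists_embedding h3
  have hsurj : Function.Surjective f := by
    intro w
    by_contra! hw
    have hmod (n : ℕ) : X n = f ⟨n % G.girth, Nat.mod_lt _ (by omega)⟩ := by
      rw [hf, hX.eq_iff]
      exact (Nat.mod_modEq _ _).symm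
    obtain ⟨s, v, hv, hadj⟩ :=
      hconn.exists_adj_off_cyclicSeq (w := w) (X := X) fun n hn ↦ hw _ ((hmod n).symm.trans hn.symm)
    have hY := hX.shift s
    obtain ⟨k, hk⟩ : ∃ k, G.girth = k + 1 := ⟨G.girth - 1, by omega⟩
    have hlast : G.Adj (X s) (X (s + k)) := by
      have := hY.adj k
      rw [← hk, hY.apply_self] at this
      exact this.symm
    have hne : X (s + 1) ≠ X (s + k) := fun heq ↦ by
      have := hY.injOn (Set.mem_Iio.2 (by omega)) (Set.mem_Iio.2 (by omega)) heq
      omega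
    have hcard : 2 < (G.neighborFinset (X s)).card :=
      Finset.two_lt_card.2 ⟨v, by simpa using hadj.symm, X (s + 1), by simpa using hX.adj s,
        X (s + k), by simpa using hlast, hv _, hv _, hne⟩
    obtain ⟨n, rfl⟩ := Nat.exists_eq_add_of_le' hm
    have hdeg := e.degree_eq (X s)
    rw [cycleGraph_degree_three_le] at hdeg
    rw [card_neighborFinset_eq_degree] at hcard
    omega
  have h1 := Fintype.card_of_bijective ⟨f.injective, hsurj⟩
  have h2 := Fintype.card_congr e.toEquiv
  simp only [Fintype.card_fin] at h1 h2
  omega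

end

end SimpleGraph

/-- For a connected graph `G` containing a cycle, with girth `g`, one has
`n(G) = ⌈g/2⌉ − 1` iff `G` is a cycle `C_m` with `m ≡ 0, 1 (mod 4)`, or a complete
bipartite graph `K_{s,t}` with `s, t ≥ 2` and `s + t ≥ 5`. -/
theorem negInertia_eq_half_girth_sub_one_iff {V : Type*} [Fintype V] (G : SimpleGraph V)
    (hG : G.Connected) (hcyc : ¬ G.IsAcyclic) (g : ℕ) (hgirth : G.girth = g) :
    G.negInertia = (g + 1) / 2 - 1 ↔
      (∃ m : ℕ, 3 ≤ m ∧ (m % 4 = 0 ∨ m % 4 = 1) ∧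
        Nonempty (G ≃g SimpleGraph.cycleGraph m)) ∨
      (∃ s t : ℕ, 2 ≤ s ∧ 2 ≤ t ∧ 5 ≤ s + t ∧
        Nonempty (G ≃g completeBipartiteGraph (Fin s) (Fin t))) := by
  classical
  subst hgirth
  have h3 := SimpleGraph.three_le_girth hcyc
  constructor
  · intro hn
    obtain ⟨X, hX⟩ := SimpleGraph.exists_isCyclicSeq_girth hcyc
    obtain ⟨f, hf⟩ := hX.exists_embedding h3
    have : NeZero G.girth := ⟨by omega⟩
    have h4 : G.girth % 4 = 0 ∨ G.girth % 4 = 1 := by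
      by_contra h4
      have := SimpleGraph.half_le_negInertia_of_cycleGraph f h3 (by omega)
      omega
    by_cases hsurj : Function.Surjective f
    · exact Or.inl ⟨G.girth, h3, h4, ⟨(RelIso.ofSurjective f hsurj).symm⟩⟩
    right
    obtain ⟨w, hw⟩ := not_forall.1 hsurj
    have hwX (n : ℕ) : w ≠ X n := fun hn ↦ by
      refine hw ⟨Fin.ofNat _ n, ?_⟩
      rw [hf, hn, hX.eq_iff]
      exact Nat.mod_modEq _ _
    have hg4 : G.girth = 4 := by
      by_contra hne
      obtain ⟨s, v, hv, hadj⟩ := hG.exists_adj_off_cyclicSeq hwX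
      have := (hX.shift s).half_le_negInertia (by omega) h4 (fun n ↦ hv _) hadj
      omega
    have htri : ∀ u v w, G.Adj u v → G.Adj v w → ¬ G.Adj u w := by
      intro u v w huv hvw huw
      let Y : ℕ → V
        | 0 => u
        | 1 => v
        | _ => w
      have := SimpleGraph.girth_le_of_closed_seq (G := G) (X := Y) (k := 2) le_rfl ?_ ?_ huw.symm
      · omega
      · have h1 := huv.ne
        have h2 := hvw.ne
        have h3 := huw.ne
        intro i hi j hj hij
        rw [Set.mem_Iic] at hi hj
        interval_cases i <;> interval_cases j <;> simp_all [Y]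
      · intro i hi
        interval_cases i
        · exact huv
        · exact hvw
    have hiff := hG.adj_iff_of_negInertia_le_one htri (by omega) (hX.adj 0)
    have hne (i j : ℕ) (hi : i < 4) (hj : j < 4) (hij : i ≠ j) : X i ≠ X j := fun h ↦
      hij (hX.injOn (Set.mem_Iio.2 (by omega)) (Set.mem_Iio.2 (by omega)) h)
    have h03 : G.Adj (X 0) (X 3) := by
      have := hX.adj 3
      rw [show 3 + 1 = G.girth by omega, hX.apply_self] at this
      exact this.symm
    have h02 : ¬ G.Adj (X 0) (X 2) := htri _ _ _ (hX.adj 0) (hX.adj 1)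
    refine ⟨Fintype.card {v // G.Adj (X 0) v}, Fintype.card {v // ¬ G.Adj (X 0) v},
      ?_, ?_, ?_, SimpleGraph.nonempty_iso_completeBipartiteGraph _ hiff⟩
    · refine Fintype.one_lt_card_iff.2 ⟨⟨X 1, hX.adj 0⟩, ⟨X 3, h03⟩, fun h ↦ ?_⟩
      exact hne 1 3 (by omega) (by omega) (by omega) (congrArg Subtype.val h)
    · refine Fintype.one_lt_card_iff.2 ⟨⟨X 0, G.irrefl⟩, ⟨X 2, h02⟩, fun h ↦ ?_⟩
      exact hne 0 2 (by omega) (by omega) (by omega) (congrArg Subtype.val h)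
    · have hlt := Fintype.card_lt_of_injective_not_surjective f f.injective hsurj
      rw [Fintype.card_fin] at hlt
      have := Fintype.card_congr (Equiv.sumCompl (G.Adj (X 0)))
      rw [Fintype.card_sum] at this
      omega
  · rintro (⟨m, hm, h4, ⟨e⟩⟩ | ⟨s, t, hs, ht, -, ⟨e⟩⟩)
    · have : NeZero m := ⟨by omega⟩
      rw [SimpleGraph.girth_of_iso_cycleGraph hG hcyc hm e]
      exact le_antisymm (SimpleGraph.negInertia_le_of_iso_cycleGraph e.symm hm h4)
        (SimpleGraph.half_sub_one_le_negInertia_of_cycleGraph e.symm.toEmbedding hm)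
    · rw [SimpleGraph.girth_of_iso_completeBipartiteGraph hs ht hcyc e]
      obtain ⟨X, hX⟩ := SimpleGraph.exists_isCyclicSeq_girth hcyc
      exact le_antisymm (SimpleGraph.negInertia_le_one_of_iso_completeBipartiteGraph e.symm)
        (SimpleGraph.one_le_negInertia_of_adj (hX.adj 0))
end

section
/- Let G be the theta graph B(5,5,5): the graph obtained from two vertices u and v joined by three internally disjoint paths, each path having 5 vertices including its endpoints u and v (so each path has 3 internal vertices and length 4; G has 11 vertices in total). Then n(G) = 4. -/
/-- The theta graph `B(5,5,5)`: vertices `0` and `1` joined by the three internally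
disjoint paths `0-2-3-4-1`, `0-5-6-7-1` and `0-8-9-10-1`, each with `5` vertices
(so each of length `4`); `11` vertices in total. -/
def thetaB555 : SimpleGraph (Fin 11) :=
  SimpleGraph.fromRel (fun x y =>
    (x, y) ∈ ([(0, 2), (2, 3), (3, 4), (4, 1),
               (0, 5), (5, 6), (6, 7), (7, 1),
               (0, 8), (8, 9), (9, 10), (10, 1)] : List (Fin 11 × Fin 11)))

open Polynomial in
/-- A polynomial annihilating a Hermitian matrix vanishes at its eigenvalues. -/
lemma Matrix.IsHermitian.eval_eigenvalues_eq_zero {n : Type*} [Fintype n] [DecidableEq n]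
    {A : Matrix n n ℝ} (hA : A.IsHermitian) {p : ℝ[X]} (hp : aeval A p = 0) (i : n) :
    p.eval (hA.eigenvalues i) = 0 := by
  have : Nonempty n := ⟨i⟩
  have h := spectrum.subset_polynomial_aeval A p
    (Set.mem_image_of_mem _ (hA.eigenvalues_mem_spectrum_real i))
  simpa [hp, spectrum.zero_eq] using h

/-- The trace of a power of a Hermitian matrix is the corresponding power sum of its
eigenvalues. -/
lemma Matrix.IsHermitian.trace_pow_eq_sum_eigenvalues_pow {n : Type*} [Fintype n]
    [DecidableEq n] {A : Matrix n n ℝ} (hA : A.IsHermitian) (k : ℕ) :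
    (A ^ k).trace = ∑ i, hA.eigenvalues i ^ k := by
  conv_lhs => rw [hA.spectral_theorem, ← map_pow, Unitary.conjStarAlgAut_apply,
    Matrix.trace_mul_comm, ← mul_assoc]
  simp [Matrix.diagonal_pow, Matrix.trace_diagonal]

/-- The indicator of the negative reals, interpolated on `{0, ±√2, ±√3, ±√5}` by a polynomial. -/
lemma exists_interpolation_indicator_neg : ∃ a b c : ℝ, ∀ x : ℝ,
    x * ((x ^ 2 - 2) * (x ^ 2 - 3) * (x ^ 2 - 5)) = 0 →
    (if x < 0 then 1 else 0 : ℝ) =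
      (x ^ 6 - 10 * x ^ 4 + 31 * x ^ 2) / 60 + (a * x + b * x ^ 3 + c * x ^ 5) := by
  obtain ⟨p, hp, hp2⟩ : ∃ p : ℝ, 0 < p ∧ p ^ 2 = 2 := ⟨√2, by positivity, by norm_num⟩
  obtain ⟨q, hq, hq2⟩ : ∃ q : ℝ, 0 < q ∧ q ^ 2 = 3 := ⟨√3, by positivity, by norm_num⟩
  obtain ⟨r, hr, hr2⟩ : ∃ r : ℝ, 0 < r ∧ r ^ 2 = 5 := ⟨√5, by positivity, by norm_num⟩
  refine ⟨-(15 * (p / 6) - 10 * (q / 6) + 6 * (r / 30)) / 2,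
    -(-8 * (p / 6) + 7 * (q / 6) - 5 * (r / 30)) / 2,
    -(p / 6 - q / 6 + r / 30) / 2, fun x hx ↦ ?_⟩
  have key : ∀ {s : ℝ}, 0 < s → x ^ 2 = s ^ 2 → (x = s ∧ ¬ x < 0) ∨ (x = -s ∧ x < 0) := by
    intro s hs h
    rcases sq_eq_sq_iff_eq_or_eq_neg.mp h with h | h
    · exact .inl ⟨h, by linarith⟩
    · exact .inr ⟨h, by linarith⟩
  rcases mul_eq_zero.mp hx with h | h
  · simp [h]
  rcases mul_eq_zero.mp h with h | h
  · rcases mul_eq_zero.mp h with h | h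
    · have h2 : x ^ 2 = 2 := by linarith
      rcases key hp (by linarith) with ⟨e, h0⟩ | ⟨e, h0⟩ <;> simp only [h0, if_true, if_false] <;>
        subst e <;> grind
    · have h2 : x ^ 2 = 3 := by linarith
      rcases key hq (by linarith) with ⟨e, h0⟩ | ⟨e, h0⟩ <;> simp only [h0, if_true, if_false] <;>
        subst e <;> grind
  · have h2 : x ^ 2 = 5 := by linarith
    rcases key hr (by linarith) with ⟨e, h0⟩ | ⟨e, h0⟩ <;> simp only [h0, if_true, if_false] <;>
      subst e <;> grind

/-- The integer adjacency matrix of `thetaB555`. -/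
def thetaMatrix : Matrix (Fin 11) (Fin 11) ℤ :=
  !![0, 0, 1, 0, 0, 1, 0, 0, 1, 0, 0;
     0, 0, 0, 0, 1, 0, 0, 1, 0, 0, 1;
     1, 0, 0, 1, 0, 0, 0, 0, 0, 0, 0;
     0, 0, 1, 0, 1, 0, 0, 0, 0, 0, 0;
     0, 1, 0, 1, 0, 0, 0, 0, 0, 0, 0;
     1, 0, 0, 0, 0, 0, 1, 0, 0, 0, 0;
     0, 0, 0, 0, 0, 1, 0, 1, 0, 0, 0;
     0, 1, 0, 0, 0, 0, 1, 0, 0, 0, 0;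
     1, 0, 0, 0, 0, 0, 0, 0, 0, 1, 0;
     0, 0, 0, 0, 0, 0, 0, 0, 1, 0, 1;
     0, 1, 0, 0, 0, 0, 0, 0, 0, 1, 0]

lemma thetaMatrix_sq : thetaMatrix ^ 2 =
  !![3, 0, 0, 1, 0, 0, 1, 0, 0, 1, 0;
     0, 3, 0, 1, 0, 0, 1, 0, 0, 1, 0;
     0, 0, 2, 0, 1, 1, 0, 0, 1, 0, 0;
     1, 1, 0, 2, 0, 0, 0, 0, 0, 0, 0;
     0, 0, 1, 0, 2, 0, 0, 1, 0, 0, 1;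
     0, 0, 1, 0, 0, 2, 0, 1, 1, 0, 0;
     1, 1, 0, 0, 0, 0, 2, 0, 0, 0, 0;
     0, 0, 0, 0, 1, 1, 0, 2, 0, 0, 1;
     0, 0, 1, 0, 0, 1, 0, 0, 2, 0, 1;
     1, 1, 0, 0, 0, 0, 0, 0, 0, 2, 0;
     0, 0, 0, 0, 1, 0, 0, 1, 1, 0, 2] := by
  rw [pow_two]
  decide +kernel

lemma thetaMatrix_cube : thetaMatrix ^ 3 =
  !![0, 0, 4, 0, 1, 4, 0, 1, 4, 0, 1;
     0, 0, 1, 0, 4, 1, 0, 4, 1, 0, 4;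
     4, 1, 0, 3, 0, 0, 1, 0, 0, 1, 0;
     0, 0, 3, 0, 3, 1, 0, 1, 1, 0, 1;
     1, 4, 0, 3, 0, 0, 1, 0, 0, 1, 0;
     4, 1, 0, 1, 0, 0, 3, 0, 0, 1, 0;
     0, 0, 1, 0, 1, 3, 0, 3, 1, 0, 1;
     1, 4, 0, 1, 0, 0, 3, 0, 0, 1, 0;
     4, 1, 0, 1, 0, 0, 1, 0, 0, 3, 0;
     0, 0, 1, 0, 1, 1, 0, 1, 3, 0, 3;
     1, 4, 0, 1, 0, 0, 1, 0, 0, 3, 0] := by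
  rw [pow_succ, thetaMatrix_sq]
  decide +kernel

lemma thetaMatrix_annihilated :
    thetaMatrix * ((thetaMatrix ^ 2 - 2) * (thetaMatrix ^ 2 - 3) * (thetaMatrix ^ 2 - 5)) = 0 := by
  rw [thetaMatrix_sq]
  decide +kernel

lemma trace_thetaMatrix : thetaMatrix.trace = 0 := by decide +kernel

lemma trace_thetaMatrix_sq : (thetaMatrix ^ 2).trace = 24 := by
  rw [thetaMatrix_sq]; decide +kernel

lemma trace_thetaMatrix_cube : (thetaMatrix ^ 3).trace = 0 := by
  rw [thetaMatrix_cube]; decide +kernel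

lemma trace_thetaMatrix_pow_four : (thetaMatrix ^ 4).trace = 84 := by
  rw [show 4 = 2 + 2 from rfl, pow_add, thetaMatrix_sq]; decide +kernel

lemma trace_thetaMatrix_pow_five : (thetaMatrix ^ 5).trace = 0 := by
  rw [show 5 = 2 + 3 from rfl, pow_add, thetaMatrix_sq, thetaMatrix_cube]; decide +kernel

lemma trace_thetaMatrix_pow_six : (thetaMatrix ^ 6).trace = 336 := by
  rw [show 6 = 3 + 3 from rfl, pow_add, thetaMatrix_cube]; decide +kernel

instance : DecidableRel thetaB555.Adj := fun x y ↦
  decidable_of_iff _ (SimpleGraph.fromRel_adj _ x y).symm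

lemma adjMatrix_thetaB555 : thetaB555.adjMatrix ℤ = thetaMatrix := by
  decide +kernel

/-- The ring homomorphism transporting integer matrices to real matrices along an equivalence of
index types. -/
noncomputable def intMatrixTransport {V W : Type*} [Fintype V] [DecidableEq V] [Fintype W]
    [DecidableEq W] (e : V ≃ W) : Matrix W W ℤ →+* Matrix V V ℝ :=
  (Matrix.reindexAlgEquiv ℝ ℝ e.symm : Matrix W W ℝ →+* Matrix V V ℝ).comp
    (Int.castRingHom ℝ).mapMatrix

lemma intMatrixTransport_apply {V W : Type*} [Fintype V] [DecidableEq V] [Fintype W]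
    [DecidableEq W] (e : V ≃ W) (N : Matrix W W ℤ) (v w : V) :
    intMatrixTransport e N v w = N (e v) (e w) := by
  simp [intMatrixTransport]

lemma trace_intMatrixTransport {V W : Type*} [Fintype V] [DecidableEq V] [Fintype W]
    [DecidableEq W] (e : V ≃ W) (N : Matrix W W ℤ) :
    (intMatrixTransport e N).trace = N.trace := by
  simp only [Matrix.trace, Matrix.diag, intMatrixTransport_apply, Int.cast_sum]
  exact e.sum_comp fun w ↦ (N w w : ℝ)

/-- The theta graph `B(5,5,5)` has negative inertia index `4`. -/
theorem negInertia_thetaB555 {V : Type*} [Fintype V] (G : SimpleGraph V)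
    (h : Nonempty (G ≃g thetaB555)) : G.negInertia = 4 := by
  classical
  obtain ⟨e⟩ := h
  set M := G.adjMatrix ℝ with hMdef
  have hM : M.IsHermitian := G.adjMatrix_isHermitian
  have hMN : M = intMatrixTransport e.toEquiv thetaMatrix := by
    ext v w
    rw [intMatrixTransport_apply, ← adjMatrix_thetaB555]
    simp [hMdef, SimpleGraph.adjMatrix_apply, e.map_adj_iff]
  have power_sum (k : ℕ) : ∑ i, hM.eigenvalues i ^ k = ((thetaMatrix ^ k).trace : ℝ) := by
    rw [← hM.trace_pow_eq_sum_eigenvalues_pow, hMN, ← map_pow, trace_intMatrixTransport]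
  have root (i : V) : hM.eigenvalues i * ((hM.eigenvalues i ^ 2 - 2) *
      (hM.eigenvalues i ^ 2 - 3) * (hM.eigenvalues i ^ 2 - 5)) = 0 := by
    have hp : Polynomial.aeval M (Polynomial.X * ((Polynomial.X ^ 2 - 2) *
        (Polynomial.X ^ 2 - 3) * (Polynomial.X ^ 2 - 5)) : Polynomial ℝ) = 0 := by
      simpa [hMN, map_ofNat] using congrArg (intMatrixTransport e.toEquiv) thetaMatrix_annihilated
    simpa using hM.eval_eigenvalues_eq_zero hp i
  obtain ⟨a, b, c, habc⟩ := exists_interpolation_indicator_neg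
  have count : (Fintype.card {i // hM.eigenvalues i < 0} : ℝ) = 4 := by
    have h1 := power_sum 1
    simp only [pow_one, trace_thetaMatrix] at h1
    rw [Fintype.card_subtype, ← Finset.sum_boole]
    simp only [fun i ↦ habc _ (root i), Finset.sum_add_distrib, Finset.sum_sub_distrib,
      ← Finset.sum_div, ← Finset.mul_sum, power_sum, h1, trace_thetaMatrix_sq,
      trace_thetaMatrix_cube, trace_thetaMatrix_pow_four, trace_thetaMatrix_pow_five,
      trace_thetaMatrix_pow_six]
    norm_num
  have count' : Fintype.card {i // hM.eigenvalues i < 0} = 4 := by exact_mod_cast count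
  unfold SimpleGraph.negInertia
  convert count'
end

section
/- Let g ≥ 5 with g ≡ 0 or 1 (mod 4) and let k ≥ 1. Let G = C_g ⊕ S_k be the graph obtained from a cycle on g vertices by adding one new vertex c adjacent to exactly one vertex of the cycle, and adding k further new vertices each adjacent only to c. Then n(G) = ⌈g/2⌉. -/
/-- The graph `C_g ⊕ S_k`: a cycle on `g` vertices (the `Sum.inl` part), a star with
center `Sum.inr 0` and the `k` leaves `Sum.inr b` (`b ≠ 0`), together with an edge
joining the cycle vertex `Sum.inl 0` to the star center `Sum.inr 0`. -/
def cycleStar (g k : ℕ) : SimpleGraph (Fin g ⊕ Fin (k + 1)) :=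
  SimpleGraph.fromRel (fun x y =>
    match x, y with
    | Sum.inl a, Sum.inl b => (SimpleGraph.cycleGraph g).Adj a b
    | Sum.inl a, Sum.inr b => a.val = 0 ∧ b = 0
    | Sum.inr _, Sum.inl _ => False
    | Sum.inr a, Sum.inr b => a = 0 ∧ b ≠ 0)

open Matrix

namespace Matrix.IsHermitian

variable {V : Type*} [Fintype V] [DecidableEq V] {A : Matrix V V ℝ} (hA : A.IsHermitian)

/-- The quadratic form of a real Hermitian matrix in spectral coordinates. -/
lemma dotProduct_mulVec_eigenvectorUnitary (a : V → ℝ) :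
    ((hA.eigenvectorUnitary : Matrix V V ℝ) *ᵥ a) ⬝ᵥ
      (A *ᵥ ((hA.eigenvectorUnitary : Matrix V V ℝ) *ᵥ a)) =
      ∑ i, hA.eigenvalues i * a i ^ 2 := by
  set U : Matrix V V ℝ := (hA.eigenvectorUnitary : Matrix V V ℝ) with hU
  have h := hA.conjStarAlgAut_star_eigenvectorUnitary
  rw [Unitary.conjStarAlgAut_apply] at h
  have hs : star U = Uᵀ := by
    rw [Matrix.star_eq_conjTranspose, Matrix.conjTranspose_eq_transpose_of_trivial]
  have h2 : Uᵀ * A * U = diagonal hA.eigenvalues := by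
    rw [← hs]
    simpa [Function.comp_def] using h
  rw [dotProduct_comm, dotProduct_mulVec, ← mulVec_transpose, mulVec_mulVec, mulVec_mulVec,
    h2, dotProduct]
  refine Finset.sum_congr rfl fun i _ => ?_
  rw [mulVec_diagonal]
  ring

lemma finrank_le_card_neg_eigenvalues_s13 {E : Type*} [AddCommGroup E] [Module ℝ E]
    [FiniteDimensional ℝ E] (f : E →ₗ[ℝ] V → ℝ)
    (hf : ∀ y, 0 ≤ f y ⬝ᵥ (A *ᵥ f y) → y = 0) :
    Module.finrank ℝ E ≤ Fintype.card {i // hA.eigenvalues i < 0} := by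
  set U : Matrix V V ℝ := (hA.eigenvectorUnitary : Matrix V V ℝ) with hU
  have hUU : U * star U = 1 := Unitary.mul_star_self_of_mem hA.eigenvectorUnitary.2
  let φ : E →ₗ[ℝ] ({i // hA.eigenvalues i < 0} → ℝ) :=
    LinearMap.funLeft ℝ ℝ Subtype.val ∘ₗ (star U).mulVecLin ∘ₗ f
  have hφ : Function.Injective φ := by
    rw [injective_iff_map_eq_zero]
    intro y hy
    apply hf
    have key := hA.dotProduct_mulVec_eigenvectorUnitary (star U *ᵥ f y)
    rw [mulVec_mulVec, ← hU, hUU, one_mulVec] at key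
    rw [key]
    refine Finset.sum_nonneg fun i _ => ?_
    rcases lt_or_ge (hA.eigenvalues i) 0 with hi | hi
    · have : (star U *ᵥ f y) i = 0 := congrFun hy ⟨i, hi⟩
      simp [this]
    · positivity
  simpa using LinearMap.finrank_le_finrank_of_injective hφ

lemma card_neg_eigenvalues_le_finrank {F : Type*} [AddCommGroup F] [Module ℝ F]
    [FiniteDimensional ℝ F] (L : (V → ℝ) →ₗ[ℝ] F)
    (hL : ∀ x, L x = 0 → 0 ≤ x ⬝ᵥ (A *ᵥ x)) :
    Fintype.card {i // hA.eigenvalues i < 0} ≤ Module.finrank ℝ F := by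
  set U : Matrix V V ℝ := (hA.eigenvectorUnitary : Matrix V V ℝ) with hU
  let φ : ({i // hA.eigenvalues i < 0} → ℝ) →ₗ[ℝ] F :=
    L ∘ₗ U.mulVecLin ∘ₗ Function.ExtendByZero.linearMap ℝ Subtype.val
  have hφ : Function.Injective φ := by
    rw [injective_iff_map_eq_zero]
    intro a ha
    set b : V → ℝ := Function.extend Subtype.val a 0 with hb
    have hval (i : {i // hA.eigenvalues i < 0}) : b i = a i :=
      Subtype.val_injective.extend_apply _ _ _
    have hzero (i : V) (hi : ¬ hA.eigenvalues i < 0) : b i = 0 :=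
      Function.extend_apply' _ _ _ (by rintro ⟨j, rfl⟩; exact hi j.2)
    have key := hL (U *ᵥ b) ha
    rw [hU, hA.dotProduct_mulVec_eigenvectorUnitary] at key
    have hnonpos : ∀ i ∈ Finset.univ, hA.eigenvalues i * b i ^ 2 ≤ 0 := by
      intro i _
      by_cases hi : hA.eigenvalues i < 0
      · exact mul_nonpos_of_nonpos_of_nonneg hi.le (sq_nonneg _)
      · simp [hzero i hi]
    have hsum := (Finset.sum_eq_zero_iff_of_nonpos hnonpos).1
      (le_antisymm (Finset.sum_nonpos hnonpos) key)
    funext i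
    have := hsum i (Finset.mem_univ _)
    rw [hval] at this
    simpa [i.2.ne] using this
  simpa using LinearMap.finrank_le_finrank_of_injective hφ

end Matrix.IsHermitian

namespace SimpleGraph

variable {V : Type*} [Fintype V] (G : SimpleGraph V) [DecidableRel G.Adj]

lemma finrank_le_negInertia {E : Type*} [AddCommGroup E] [Module ℝ E]
    [FiniteDimensional ℝ E] (f : E →ₗ[ℝ] V → ℝ)
    (hf : ∀ y, 0 ≤ f y ⬝ᵥ (G.adjMatrix ℝ *ᵥ f y) → y = 0) :
    Module.finrank ℝ E ≤ G.negInertia := by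
  classical
  unfold negInertia
  convert G.adjMatrix_isHermitian.finrank_le_card_neg_eigenvalues_s13 f _
  convert hf

lemma negInertia_le_finrank {F : Type*} [AddCommGroup F] [Module ℝ F]
    [FiniteDimensional ℝ F] (L : (V → ℝ) →ₗ[ℝ] F)
    (hL : ∀ x, L x = 0 → 0 ≤ x ⬝ᵥ (G.adjMatrix ℝ *ᵥ x)) :
    G.negInertia ≤ Module.finrank ℝ F := by
  classical
  unfold negInertia
  convert G.adjMatrix_isHermitian.card_neg_eigenvalues_le_finrank L _
  convert hL

end SimpleGraph

lemma SimpleGraph.dotProduct_cycleGraph_adjMatrix_mulVec (n : ℕ) (y : Fin (n + 3) → ℝ) :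
    y ⬝ᵥ ((SimpleGraph.cycleGraph (n + 3)).adjMatrix ℝ *ᵥ y) = 2 * ∑ i, y i * y (i + 1) := by
  have hne (i : Fin (n + 3)) : i - 1 ≠ i + 1 := by
    intro h
    have h2 : i - 1 + 1 = i + 1 + 1 := congrArg (· + 1) h
    rw [sub_add_cancel, add_assoc, left_eq_add] at h2
    exact absurd (congrArg Fin.val h2) (by simp [Fin.val_add, Nat.mod_eq_of_lt])
  have hshift : ∑ i, y i * y (i - 1) = ∑ i, y i * y (i + 1) := by
    rw [← Equiv.sum_comp (Equiv.addRight (1 : Fin (n + 3)))]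
    simp [mul_comm]
  simp only [dotProduct, SimpleGraph.adjMatrix_mulVec_apply,
    SimpleGraph.cycleGraph_neighborFinset, Finset.sum_pair (hne _), mul_add,
    Finset.sum_add_distrib, hshift]
  ring

section CycleStar

variable {g k : ℕ}

@[simp] lemma cycleStar_adj_inl_inl (a b : Fin g) :
    (cycleStar g k).Adj (.inl a) (.inl b) ↔ (SimpleGraph.cycleGraph g).Adj a b := by
  simp only [cycleStar, SimpleGraph.fromRel_adj, ne_eq, Sum.inl.injEq]
  constructor
  · rintro ⟨_, h | h⟩
    exacts [h, h.symm]
  · exact fun h => ⟨h.ne, .inl h⟩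

@[simp] lemma cycleStar_adj_inl_inr (a : Fin g) (b : Fin (k + 1)) :
    (cycleStar g k).Adj (.inl a) (.inr b) ↔ a.val = 0 ∧ b = 0 := by
  simp [cycleStar]

@[simp] lemma cycleStar_adj_inr_inl (a : Fin g) (b : Fin (k + 1)) :
    (cycleStar g k).Adj (.inr b) (.inl a) ↔ a.val = 0 ∧ b = 0 := by
  simp [cycleStar]

@[simp] lemma cycleStar_adj_inr_inr (a b : Fin (k + 1)) :
    (cycleStar g k).Adj (.inr a) (.inr b) ↔ a = 0 ∧ b ≠ 0 ∨ b = 0 ∧ a ≠ 0 := by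
  simp only [cycleStar, SimpleGraph.fromRel_adj, ne_eq, Sum.inr.injEq]
  grind

end CycleStar

lemma dotProduct_cycleStar_adjMatrix_mulVec (n k : ℕ) [DecidableRel (cycleStar (n + 3) k).Adj]
    (x : Fin (n + 3) ⊕ Fin (k + 1) → ℝ) :
    x ⬝ᵥ ((cycleStar (n + 3) k).adjMatrix ℝ *ᵥ x) =
      2 * (∑ i : Fin (n + 3), x (.inl i) * x (.inl (i + 1)) + x (.inl 0) * x (.inr 0) +
        x (.inr 0) * ∑ j : Fin k, x (.inr j.succ)) := by
  have hcyc := SimpleGraph.dotProduct_cycleGraph_adjMatrix_mulVec n (fun i => x (.inl i))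
  have hzero (a : Fin (n + 3)) : (a : ℕ) = 0 ↔ a = 0 := Fin.val_eq_zero_iff
  simp only [dotProduct, mulVec, SimpleGraph.adjMatrix_apply] at hcyc
  simp only [dotProduct, mulVec, SimpleGraph.adjMatrix_apply, Fintype.sum_sum_type,
    cycleStar_adj_inl_inl, cycleStar_adj_inl_inr, cycleStar_adj_inr_inl, cycleStar_adj_inr_inr,
    mul_add, Finset.sum_add_distrib, hcyc, hzero]
  simp [Fin.sum_univ_succ (n := k), ite_and, Fin.succ_ne_zero, ← Finset.sum_mul]
  ring

/-- The quadratic form of `C_g ⊕ S_k` in terms of a sequence extending the values on the cycle. -/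
lemma dotProduct_cycleStar_adjMatrix_mulVec_of_seq {n k : ℕ}
    [DecidableRel (cycleStar (n + 3) k).Adj] {x : Fin (n + 3) ⊕ Fin (k + 1) → ℝ} {X : ℕ → ℝ}
    (hX : ∀ i : Fin (n + 3), x (.inl i) = X i) :
    x ⬝ᵥ ((cycleStar (n + 3) k).adjMatrix ℝ *ᵥ x) =
      2 * (∑ i ∈ Finset.range (n + 2), X i * X (i + 1) + X (n + 2) * X 0 + X 0 * x (.inr 0) +
        x (.inr 0) * ∑ j : Fin k, x (.inr j.succ)) := by
  rw [dotProduct_cycleStar_adjMatrix_mulVec]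
  simp only [hX, Fin.sum_univ_castSucc (n := n + 2), Finset.sum_range, Fin.val_castSucc,
    Fin.val_last, Fin.last_add_one, Fin.val_zero, Fin.coeSucc_eq_succ, Fin.val_succ]

lemma sum_range_two_mul {M : Type*} [AddCommMonoid M] (f : ℕ → M) (t : ℕ) :
    ∑ i ∈ Finset.range (2 * t), f i = ∑ j ∈ Finset.range t, (f (2 * j) + f (2 * j + 1)) := by
  induction t with
  | zero => simp
  | succ t ih => rw [mul_add_one, Finset.sum_range_succ, Finset.sum_range_succ, ih,
      Finset.sum_range_succ, add_assoc]

lemma negInertia_cycleStar_le {n k r : ℕ} (hr : n + 3 = 2 * r + 1 ∧ Even r ∨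
    n + 3 = 2 * r + 2 ∧ Odd r) : (cycleStar (n + 3) k).negInertia ≤ r + 1 := by
  classical
  let v (i : ℕ) (hi : i < n + 3) : (Fin (n + 3) ⊕ Fin (k + 1) → ℝ) →ₗ[ℝ] ℝ :=
    LinearMap.proj (.inl ⟨i, hi⟩)
  let L : (Fin (n + 3) ⊕ Fin (k + 1) → ℝ) →ₗ[ℝ] (Fin r → ℝ) × ℝ :=
    (LinearMap.pi fun j : Fin r =>
      v (2 * j) (by omega) + v (2 * j + 2) (by omega)).prod (LinearMap.proj (.inr 0))
  have h := SimpleGraph.negInertia_le_finrank (cycleStar (n + 3) k) L ?_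
  · simpa using h
  intro x hx
  obtain ⟨X, hX⟩ : ∃ X : ℕ → ℝ, ∀ i : Fin (n + 3), x (.inl i) = X i :=
    ⟨fun i => if h : i < n + 3 then x (.inl ⟨i, h⟩) else 0, fun i => by simp⟩
  have hc : x (.inr 0) = 0 := congrArg Prod.snd hx
  have hs (j : ℕ) (hj : j < r) : X (2 * j) + X (2 * j + 2) = 0 := by
    have : x (.inl ⟨2 * j, by omega⟩) + x (.inl ⟨2 * j + 2, by omega⟩) = 0 :=
      congrFun (congrArg Prod.fst hx) ⟨j, hj⟩
    simpa [hX] using this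
  have halt (j : ℕ) (hj : j ≤ r) : X (2 * j) = (-1) ^ j * X 0 := by
    induction j with
    | zero => simp
    | succ j ih =>
      rw [pow_succ, mul_add_one]
      linarith [hs j hj, ih (by omega)]
  have hsum : ∑ i ∈ Finset.range (2 * r), X i * X (i + 1) = 0 := by
    rw [sum_range_two_mul]
    refine Finset.sum_eq_zero fun j hj => ?_
    linear_combination X (2 * j + 1) * hs j (Finset.mem_range.1 hj)
  rw [dotProduct_cycleStar_adjMatrix_mulVec_of_seq hX, hc]
  obtain ⟨h, hr⟩ | ⟨h, hr⟩ := hr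
  · obtain h : n + 2 = 2 * r := by omega
    rw [h, hsum, halt r le_rfl, hr.neg_one_pow]
    nlinarith [mul_self_nonneg (X 0)]
  · obtain h : n + 2 = 2 * r + 1 := by omega
    rw [h, Finset.sum_range_succ, hsum, halt r le_rfl, hr.neg_one_pow]
    apply le_of_eq
    ring

/-- Extends `y` by zero and interlaces it with the negated sums of consecutive terms. -/
def interlace (r : ℕ) : (Fin r → ℝ) →ₗ[ℝ] ℕ → ℝ :=
  let Y (j : ℕ) : (Fin r → ℝ) →ₗ[ℝ] ℝ := if h : j < r then LinearMap.proj ⟨j, h⟩ else 0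
  LinearMap.pi fun i =>
    if i = 0 then 0 else if i % 2 = 1 then Y (i / 2) else -(Y (i / 2 - 1) + Y (i / 2))

section Interlace

variable {r : ℕ} (y : Fin r → ℝ)

lemma interlace_zero : interlace r y 0 = 0 := by
  simp [interlace]

lemma interlace_odd (j : Fin r) : interlace r y (2 * j + 1) = y j := by
  have : (2 * (j : ℕ) + 1) / 2 = j := by omega
  simp [interlace, this]

lemma interlace_last : interlace r y (2 * r + 1) = 0 := by
  have : (2 * r + 1) / 2 = r := by omega
  simp [interlace, this]

lemma interlace_even (j : ℕ) : interlace r y (2 * j + 2) =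
    -(interlace r y (2 * j + 1) + interlace r y (2 * (j + 1) + 1)) := by
  have h₁ : (2 * j + 1) / 2 = j := by omega
  have h₂ : (2 * j + 2) / 2 = j + 1 := by omega
  have h₃ : (2 * (j + 1) + 1) / 2 = j + 1 := by omega
  have h₄ : (2 * j + 2) % 2 ≠ 1 := by omega
  have h₅ : (2 * j + 1) % 2 = 1 := by omega
  have h₆ : (2 * (j + 1) + 1) % 2 = 1 := by omega
  simp only [interlace, LinearMap.pi_apply, h₁, h₂, h₃, if_neg h₄, if_pos h₅, if_pos h₆]
  simp

lemma sum_interlace : ∑ i ∈ Finset.range (2 * r + 1), interlace r y i * interlace r y (i + 1) =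
    -∑ j ∈ Finset.range r,
      (interlace r y (2 * j + 1) + interlace r y (2 * (j + 1) + 1)) ^ 2 := by
  rw [Finset.sum_range_succ', sum_range_two_mul, interlace_zero, zero_mul, add_zero,
    ← Finset.sum_neg_distrib]
  refine Finset.sum_congr rfl fun j _ => ?_
  rw [add_assoc (2 * j) 1 1, one_add_one_eq_two, interlace_even]
  ring_nf

end Interlace

lemma le_negInertia_cycleStar {n k r : ℕ} (hk : 1 ≤ k)
    (hr : n + 3 = 2 * r + 1 ∨ n + 3 = 2 * r + 2) :
    r + 1 ≤ (cycleStar (n + 3) k).negInertia := by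
  classical
  obtain ⟨k, rfl⟩ : ∃ l, k = l + 1 := ⟨k - 1, by omega⟩
  let f : (Fin r → ℝ) × ℝ →ₗ[ℝ] Fin (n + 3) ⊕ Fin (k + 1 + 1) → ℝ :=
    LinearMap.pi (Sum.elim
      (fun i => LinearMap.proj (i : ℕ) ∘ₗ interlace r ∘ₗ LinearMap.fst ℝ _ _)
      (Fin.cons (LinearMap.snd ℝ _ _) (Fin.cons (-LinearMap.snd ℝ _ _) 0)))
  have h := SimpleGraph.finrank_le_negInertia (cycleStar (n + 3) (k + 1)) f ?_
  · simpa using h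
  rintro ⟨y, z⟩ hyz
  have hX (i : Fin (n + 3)) : f (y, z) (.inl i) = interlace r y i := rfl
  have hc : f (y, z) (.inr 0) = z := rfl
  have hl : ∑ j : Fin (k + 1), f (y, z) (.inr j.succ) = -z := by
    rw [Fin.sum_univ_succ]
    simp [f]
  have hsum : ∑ i ∈ Finset.range (n + 2), interlace r y i * interlace r y (i + 1) =
      ∑ i ∈ Finset.range (2 * r + 1), interlace r y i * interlace r y (i + 1) := by
    obtain h | h := hr
    · rw [Finset.sum_range_succ _ (2 * r), interlace_last, mul_zero, add_zero,
        show n + 2 = 2 * r by omega]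
    · rw [show n + 2 = 2 * r + 1 by omega]
  rw [dotProduct_cycleStar_adjMatrix_mulVec_of_seq hX, hc, hl, hsum, sum_interlace,
    interlace_zero] at hyz
  have hnonneg : ∀ j ∈ Finset.range r,
      0 ≤ (interlace r y (2 * j + 1) + interlace r y (2 * (j + 1) + 1)) ^ 2 :=
    fun _ _ => sq_nonneg _
  have hS := Finset.sum_nonneg hnonneg
  have hz : z = 0 := by nlinarith
  have hS0 := (Finset.sum_eq_zero_iff_of_nonneg hnonneg).1 (by nlinarith)
  have hY (t : ℕ) (ht : t ≤ r) : interlace r y (2 * (r - t) + 1) = 0 := by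
    induction t with
    | zero => exact interlace_last y
    | succ t ih =>
      have h₁ := pow_eq_zero_iff two_ne_zero |>.1 (hS0 (r - (t + 1)) (by simp; omega))
      rwa [show r - (t + 1) + 1 = r - t by omega, ih (by omega), add_zero] at h₁
  have hy : y = 0 := by
    funext j
    have := hY (r - j) (by omega)
    rwa [Nat.sub_sub_self j.2.le, interlace_odd] at this
  rw [hy, hz, Prod.mk_zero_zero]

/-- For `g ≥ 5` with `g ≡ 0, 1 (mod 4)` and `k ≥ 1`, the graph `C_g ⊕ S_k` has
negative inertia index `⌈g/2⌉`. -/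
theorem negInertia_cycleStar (g k : ℕ) (hg : 5 ≤ g) (hmod : g % 4 = 0 ∨ g % 4 = 1)
    (hk : 1 ≤ k) : (cycleStar g k).negInertia = (g + 1) / 2 := by
  obtain ⟨n, rfl⟩ : ∃ n, g = n + 3 := ⟨g - 3, by omega⟩
  have hr : n + 3 = 2 * ((n + 2) / 2) + 1 ∧ Even ((n + 2) / 2) ∨
      n + 3 = 2 * ((n + 2) / 2) + 2 ∧ Odd ((n + 2) / 2) := by
    rw [Nat.even_iff, Nat.odd_iff]
    omega
  rw [show (n + 3 + 1) / 2 = (n + 2) / 2 + 1 by omega]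
  exact le_antisymm (negInertia_cycleStar_le hr)
    (le_negInertia_cycleStar hk (hr.imp And.left And.left))
end

section
/- Let G be a finite connected simple graph with girth g ≥ 5, g ≡ 0 or 1 (mod 4), suppose G is not a canonical unicyclic graph and n(G) = ⌈g/2⌉, and let C be a shortest cycle in G. Then every vertex of G is at distance at most 2 from V(C). -/
/-- A connected graph is a *canonical unicyclic graph* if it has exactly one cycle `C`
(any two cycles have the same edge set) and the vertices outside `C` form an
independent set. -/
def SimpleGraph.IsCanonicalUnicyclic {V : Type*} (G : SimpleGraph V) : Prop :=
  G.Connected ∧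
    ∃ (a : V) (c : G.Walk a a), c.IsCycle ∧
      (∀ (b : V) (d : G.Walk b b), d.IsCycle → ∀ e, e ∈ d.edges ↔ e ∈ c.edges) ∧
      (∀ x y : V, x ∉ c.support → y ∉ c.support → ¬ G.Adj x y)

/-- If a Hermitian matrix restricts to `-1` on the columns of a matrix with `k` columns, then it has
at least `k` negative eigenvalues. -/
lemma Matrix.IsHermitian.card_le_card_neg_eigenvalues {V ι : Type*} [Fintype V] [DecidableEq V]
    [Fintype ι] [DecidableEq ι] {A : Matrix V V ℝ} (hA : A.IsHermitian) (P : Matrix V ι ℝ)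
    (hP : P.transpose * A * P = -1) :
    Fintype.card ι ≤ Fintype.card {i // hA.eigenvalues i < 0} := by
  by_contra! hlt
  set U : Matrix V V ℝ := (hA.eigenvectorUnitary : Matrix V V ℝ)
  set Q : Matrix V ι ℝ := U.transpose * P with hQ
  have hspec : A = U * Matrix.diagonal hA.eigenvalues * U.transpose := by
    have h := hA.spectral_theorem
    rw [Unitary.conjStarAlgAut_apply] at h
    simpa [Matrix.star_eq_conjTranspose, Function.comp_def] using! h
  have hform : Q.transpose * Matrix.diagonal hA.eigenvalues * Q = -1 := by
    rw [← hP]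
    conv_rhs => rw [hspec]
    simp only [hQ, Matrix.transpose_mul, Matrix.transpose_transpose, Matrix.mul_assoc]
  let F : (ι → ℝ) →ₗ[ℝ] ({i // hA.eigenvalues i < 0} → ℝ) :=
    (LinearMap.funLeft ℝ ℝ Subtype.val).comp Q.mulVecLin
  have hker : LinearMap.ker F ≠ ⊥ := F.ker_ne_bot_of_finrank_lt (by simpa using hlt)
  obtain ⟨y, hy, hy0⟩ := (Submodule.ne_bot_iff _).mp hker
  have hzero (i : V) (hi : hA.eigenvalues i < 0) : (Q.mulVec y) i = 0 :=
    congrFun (LinearMap.mem_ker.mp hy) ⟨i, hi⟩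
  have hval : -(y ⬝ᵥ y) = ∑ i, hA.eigenvalues i * (Q.mulVec y i) ^ 2 := by
    calc -(y ⬝ᵥ y) = y ⬝ᵥ (-1 : Matrix ι ι ℝ).mulVec y := by simp [Matrix.neg_mulVec]
      _ = Q.mulVec y ⬝ᵥ (Matrix.diagonal hA.eigenvalues).mulVec (Q.mulVec y) := by
        rw [← hform, ← Matrix.mulVec_mulVec, ← Matrix.mulVec_mulVec, Matrix.dotProduct_mulVec,
          Matrix.vecMul_transpose]
      _ = _ := by
        simp only [dotProduct, Matrix.mulVec_diagonal]
        exact Finset.sum_congr rfl fun i _ ↦ by ring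
  have hnonneg : 0 ≤ ∑ i, hA.eigenvalues i * (Q.mulVec y i) ^ 2 := by
    refine Finset.sum_nonneg fun i _ ↦ ?_
    rcases lt_or_ge (hA.eigenvalues i) 0 with hi | hi
    · simp [hzero i hi]
    · positivity
  refine hy0 (dotProduct_self_eq_zero.mp (le_antisymm ?_ ?_))
  · linarith
  · exact Finset.sum_nonneg fun i _ ↦ mul_self_nonneg _

/-- A lower triangular pattern of edges between an independent family `u` and a family `w` forces
as many negative eigenvalues as there are pairs `(u i, w i)`. -/
lemma SimpleGraph.le_negInertia_of_triangular {V : Type*} [Fintype V] (G : SimpleGraph V) {k : ℕ}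
    (u w : Fin k → V) (huw : ∀ i, G.Adj (u i) (w i)) (hu : ∀ i j, ¬ G.Adj (u i) (u j))
    (htri : ∀ i j, i < j → ¬ G.Adj (u i) (w j)) : k ≤ G.negInertia := by
  classical
  set A := G.adjMatrix ℝ with hA
  let E (f : Fin k → V) : Matrix V (Fin k) ℝ := (1 : Matrix V V ℝ).submatrix id f
  have hE (f f' : Fin k → V) : (E f).transpose * A * E f' = A.submatrix f f' := by
    ext i j
    simp [E, Matrix.mul_apply, Matrix.one_apply]
  set B := A.submatrix u w with hB
  set D := A.submatrix w w with hD
  have hBdet : IsUnit B.transpose.det := by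
    have h : B.BlockTriangular OrderDual.toDual := fun i j hij ↦ by
      simp [hB, hA, htri i j hij]
    rw [Matrix.det_transpose, Matrix.det_of_isLowerTriangular B h]
    simp [hB, hA, huw]
  have hDt : D.transpose = D := by
    rw [hD, Matrix.transpose_submatrix, hA, G.transpose_adjMatrix]
  have hUU : A.submatrix u u = 0 := by
    ext i j
    simp [hA, hu i j]
  have hWU : A.submatrix w u = B.transpose := by
    rw [hB, Matrix.transpose_submatrix, hA, G.transpose_adjMatrix]
  set X : Matrix (Fin k) (Fin k) ℝ := B.transpose⁻¹ * (-(1 / 2 : ℝ) • (D + 1)) with hX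
  have hBX : B.transpose * X = -(1 / 2 : ℝ) • (D + 1) := by
    rw [hX, Matrix.mul_nonsing_inv_cancel_left _ _ hBdet]
  have hXB : X.transpose * B = -(1 / 2 : ℝ) • (D + 1) := by
    have h := congrArg Matrix.transpose hBX
    simpa [Matrix.transpose_mul, hDt] using h
  have hP : (E w + E u * X).transpose * A * (E w + E u * X) = -1 := by
    calc (E w + E u * X).transpose * A * (E w + E u * X)
        = (E w).transpose * A * E w + ((E w).transpose * A * E u) * X
          + X.transpose * ((E u).transpose * A * E w)
          + X.transpose * ((E u).transpose * A * E u) * X := by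
          simp only [Matrix.transpose_add, Matrix.transpose_mul, Matrix.add_mul, Matrix.mul_add,
            Matrix.mul_assoc]
          abel
      _ = -1 := by
          rw [hE, hE, hE, hE, hUU, hWU, hBX, hXB]
          ext i j
          simp only [Matrix.mul_zero, Matrix.zero_mul, Matrix.add_apply, Matrix.smul_apply,
            Matrix.neg_apply, Matrix.zero_apply, smul_eq_mul]
          ring
  have h := (G.adjMatrix_isHermitian).card_le_card_neg_eigenvalues _ hP
  rw [Fintype.card_fin] at h
  unfold SimpleGraph.negInertia
  convert h

/-- The two ends of a path of length at least two that are adjacent span a cycle. -/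
lemma SimpleGraph.Walk.IsPath.girth_le_length_add_one {V : Type*} {G : SimpleGraph V} {u v : V}
    {p : G.Walk u v} (hp : p.IsPath) (hlen : 2 ≤ p.length) (h : G.Adj u v) :
    G.girth ≤ p.length + 1 := by
  have hcyc : (Walk.cons h.symm p).IsCycle := by
    rw [Walk.cons_isCycle_iff]
    refine ⟨hp, fun hmem ↦ ?_⟩
    have := hp.length_eq_one_of_mem_edges (Sym2.eq_swap ▸ hmem)
    omega
  simpa using girth_le_length hcyc

/-- Segments of a cycle. -/
lemma SimpleGraph.Walk.IsCycle.exists_isPath_getVert {V : Type*} {G : SimpleGraph V} {a : V}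
    {c : G.Walk a a} (hc : c.IsCycle) {i j : ℕ} (hij : i ≤ j) (hj : j ≤ c.length)
    (hend : 0 < i ∨ j < c.length) :
    ∃ p : G.Walk (c.getVert i) (c.getVert j), p.IsPath ∧ p.length = j - i ∧
      p.support ⊆ c.support := by
  rcases hend with hi | hj'
  · have h := (hc.isPath_drop hi).take (j - i)
    refine ⟨((c.drop i).take (j - i)).copy rfl (by rw [Walk.drop_getVert]; congr 1; omega), ?_, ?_,
      ?_⟩
    · simpa using h
    · simp [Walk.take_length, Walk.drop_length]; omega
    · simp only [Walk.support_copy]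
      exact fun x hx ↦ (c.isSubwalk_drop i).support_subset
        (((c.drop i).isSubwalk_take _).support_subset hx)
  · have h := (hc.isPath_take hj').drop i
    refine ⟨((c.take j).drop i).copy (by rw [Walk.take_getVert]; congr 1; omega) rfl, ?_, ?_, ?_⟩
    · simpa using h
    · simp [Walk.take_length, Walk.drop_length]; omega
    · simp only [Walk.support_copy]
      exact fun x hx ↦ (c.isSubwalk_take j).support_subset
        (((c.take j).isSubwalk_drop _).support_subset hx)

/-- A shortest cycle has no chords. -/
lemma SimpleGraph.Walk.IsCycle.not_adj_getVert {V : Type*} {G : SimpleGraph V} {a : V}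
    {c : G.Walk a a} (hc : c.IsCycle) (hlen : c.length = G.girth) {i j : ℕ} (hi : 0 < i)
    (hij : i + 2 ≤ j) (hj : j < c.length) : ¬ G.Adj (c.getVert i) (c.getVert j) := by
  intro h
  obtain ⟨p, hp, hpl, -⟩ := hc.exists_isPath_getVert (by omega : i ≤ j) hj.le (Or.inl hi)
  have := hp.girth_le_length_add_one (by omega) h
  omega

/-- A vertex outside a shortest cycle of length at least five has at most one neighbour on it. -/
lemma SimpleGraph.Walk.IsCycle.not_adj_getVert_of_adj {V : Type*} {G : SimpleGraph V} {a x : V}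
    {c : G.Walk a a} (hc : c.IsCycle) (hlen : c.length = G.girth) (hg : 5 ≤ G.girth)
    (hx : x ∉ c.support) (hxa : G.Adj x a) {i : ℕ} (hi : 0 < i) (hi' : i < c.length) :
    ¬ G.Adj x (c.getVert i) := by
  intro h
  obtain ⟨p, hp, hpl, hps⟩ := hc.exists_isPath_getVert (Nat.zero_le i) hi'.le (Or.inr hi')
  obtain ⟨q, hq, hql, hqs⟩ := hc.exists_isPath_getVert hi'.le le_rfl (Or.inl hi)
  have hp' := (Walk.cons_isPath_iff (c.getVert_zero.symm ▸ hxa) p).mpr ⟨hp, fun hh ↦ hx (hps hh)⟩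
  have hq' := (Walk.cons_isPath_iff (c.getVert_length.symm ▸ hxa) q.reverse).mpr
    ⟨hq.reverse, fun hh ↦ hx (hqs (by simpa using hh))⟩
  have h₁ := hp'.girth_le_length_add_one (by simp; omega) h
  have h₂ := hq'.girth_le_length_add_one (by simp; omega) h
  simp only [Walk.length_cons, Walk.length_reverse] at h₁ h₂
  omega

/-- A shortest cycle together with a vertex at distance three from it forces many negative
eigenvalues. -/
lemma SimpleGraph.Walk.IsCycle.le_negInertia {V : Type*} [Fintype V] {G : SimpleGraph V}
    {a x₁ x₂ x₃ : V} {c : G.Walk a a} (hc : c.IsCycle) (hlen : c.length = G.girth)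
    (hg : 5 ≤ G.girth) (h₁a : G.Adj x₁ a) (h₃₂ : G.Adj x₃ x₂) (h₃₁ : ¬ G.Adj x₃ x₁)
    (h₁ : x₁ ∉ c.support) (h₃ : ∀ y ∈ c.support, ¬ G.Adj x₃ y) :
    (G.girth - 1) / 2 + 2 ≤ G.negInertia := by
  let f : ℕ → V
    | 0 => x₃
    | 1 => x₂
    | 2 => x₁
    | n + 3 => c.getVert n
  have hnon (i b : ℕ) (hb : b < 2 * ((G.girth - 1) / 2 + 2)) (hib : 2 * i + 1 < b) :
      ¬ G.Adj (f (2 * i)) (f b) := by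
    match i, b with
    | 0, 2 => exact h₃₁
    | 0, n + 3 => exact h₃ _ (c.getVert_mem_support n)
    | 1, n + 3 => exact hc.not_adj_getVert_of_adj hlen hg h₁ h₁a (by omega) (by omega)
    | i + 2, n + 3 =>
      exact hc.not_adj_getVert (i := 2 * i + 1) hlen (by omega) (by omega) (by omega)
  refine G.le_negInertia_of_triangular (fun i ↦ f (2 * i)) (fun i ↦ f (2 * i + 1)) ?_ ?_ ?_
  · rintro ⟨i, hi⟩
    match i with
    | 0 => exact h₃₂
    | 1 => simpa [f] using h₁a
    | i + 2 => exact c.adj_getVert_succ (i := 2 * i + 1) (by omega)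
  · intro i j h
    rcases lt_trichotomy i j with hij | rfl | hij
    · exact hnon i (2 * j) (by omega) (by omega) h
    · exact G.irrefl h
    · exact hnon j (2 * i) (by omega) (by omega) h.symm
  · intro i j hij
    exact hnon i _ (by omega) (by omega)

/-- Let `G` be connected with girth `g ≥ 5`, `g ≡ 0, 1 (mod 4)`, not a canonical
unicyclic graph, with `n(G) = ⌈g/2⌉`, and let `C` be a shortest cycle. Then every
vertex of `G` is at distance at most `2` from `V(C)`. -/
theorem dist_le_two_of_negInertia_eq_half_girth {V : Type*} [Fintype V] (G : SimpleGraph V)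
    (hG : G.Connected) (g : ℕ) (hgirth : G.girth = g) (hg : 5 ≤ g)
    (hmod : g % 4 = 0 ∨ g % 4 = 1) (hnc : ¬ G.IsCanonicalUnicyclic)
    (hn : G.negInertia = (g + 1) / 2)
    {a : V} (c : G.Walk a a) (hc : c.IsCycle) (hclen : c.length = g) :
    ∀ x : V, ∃ y ∈ c.support, G.dist x y ≤ 2 := by
  classical
  intro x
  by_contra! hfar
  obtain ⟨b, hb, hmin⟩ := c.support.toFinset.exists_min_image (G.dist x) ⟨a, by simp⟩
  simp only [List.mem_toFinset] at hb hmin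
  obtain ⟨p, hp⟩ := hG.exists_walk_length_eq_dist x b
  have hd : 3 ≤ p.length := hp ▸ hfar b hb
  set d := p.length
  have hadj (i : ℕ) (hi : i < d) : G.Adj (p.getVert i) (p.getVert (i + 1)) :=
    p.adj_getVert_succ hi
  have hprefix (i : ℕ) : G.dist x (p.getVert i) ≤ i :=
    (SimpleGraph.dist_le (p.take i)).trans (by simp [SimpleGraph.Walk.take_length])
  have hlow (i : ℕ) (hi : i ≤ d) (y : V) (hy : y ∈ c.support) :
      d ≤ i + G.dist (p.getVert i) y := by
    have h₁ := hG.dist_triangle (u := x) (v := p.getVert i) (w := y)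
    have h₂ := hprefix i
    have h₃ := hmin y hy
    omega
  have hb' (y : V) : y ∈ (c.rotate b hb).support ↔ y ∈ c.support := c.mem_support_rotate_iff b hb
  have key := (hc.rotate hb).le_negInertia (x₁ := p.getVert (d - 1)) (x₂ := p.getVert (d - 2))
    (x₃ := p.getVert (d - 3)) (by rw [SimpleGraph.Walk.length_rotate]; omega) (by omega)
    (by simpa [d, Nat.sub_add_cancel (by omega : 1 ≤ d)] using hadj (d - 1) (by omega))
    (by simpa [(by omega : d - 3 + 1 = d - 2)] using hadj (d - 3) (by omega))
    (fun h ↦ by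
      have h₁ := hG.dist_triangle (u := x) (v := p.getVert (d - 3)) (w := p.getVert (d - 1))
      have h₂ := hG.dist_triangle (u := x) (v := p.getVert (d - 1)) (w := b)
      have h₃ := hprefix (d - 3)
      have h₄ := SimpleGraph.dist_eq_one_iff_adj.mpr h
      have h₅ : G.dist (p.getVert (d - 1)) b = 1 := SimpleGraph.dist_eq_one_iff_adj.mpr
        (by simpa [d, Nat.sub_add_cancel (by omega : 1 ≤ d)] using hadj (d - 1) (by omega))
      omega)
    (fun h ↦ by
      have := hlow (d - 1) (by omega) _ ((hb' _).mp h)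
      rw [SimpleGraph.dist_self] at this
      omega)
    (fun y hy h ↦ by
      have := hlow (d - 3) (by omega) y ((hb' _).mp hy)
      rw [SimpleGraph.dist_eq_one_iff_adj.mpr h] at this
      omega)
  omega
end

section
/- Let G be a finite connected simple graph with girth g ≥ 5, g ≡ 0 or 1 (mod 4), suppose G is not a canonical unicyclic graph and n(G) = ⌈g/2⌉, and let C be a shortest cycle in G. Then every vertex of G at distance exactly 1 from V(C) has exactly one neighbor on C. -/
namespace SimpleGraph

/-- A path whose two distinct ends are adjacent to a common vertex off the path closes up to a
cycle, so its length is at least the girth minus two. -/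
lemma Walk.IsPath.girth_le_length_add_two {V : Type*} {G : SimpleGraph V} {x y z : V}
    {p : G.Walk y z} (hp : p.IsPath) (hyz : y ≠ z) (hx : x ∉ p.support)
    (hxy : G.Adj x y) (hxz : G.Adj x z) : G.girth ≤ p.length + 2 := by
  have hcyc : (Walk.cons hxy (p.concat hxz.symm)).IsCycle := by
    refine (Walk.cons_isCycle_iff _ _).mpr ⟨hp.concat hx hxz.symm, fun h => ?_⟩
    rw [Walk.edges_concat, List.concat_eq_append, List.mem_append, List.mem_singleton] at h
    rcases h with h | h
    · exact hx (p.fst_mem_support_of_mem_edges h)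
    · rcases Sym2.eq_iff.mp h with ⟨h, -⟩ | ⟨-, h⟩
      · exact hxz.ne h
      · exact hyz h
  simpa using girth_le_length hcyc

/-- Two distinct vertices on a cycle with a common neighbor off the cycle force the girth to be
small compared to the length of the cycle. -/
lemma Walk.IsCycle.two_mul_girth_le_length_add_four {V : Type*} {G : SimpleGraph V} {a x y z : V}
    {c : G.Walk a a} (hc : c.IsCycle) (hx : x ∉ c.support) (hy : y ∈ c.support)
    (hz : z ∈ c.support) (hyz : y ≠ z) (hxy : G.Adj x y) (hxz : G.Adj x z) :
    2 * G.girth ≤ c.length + 4 := by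
  classical
  set d := c.rotate y hy
  have hdc : d.IsCycle := hc.rotate hy
  have hzd : z ∈ d.support := (c.mem_support_rotate_iff y hy).mpr hz
  have hxd : x ∉ d.support := fun h => hx ((c.mem_support_rotate_iff y hy).mp h)
  have hspec := d.take_spec hzd
  have hdrop : (d.dropUntil z hzd).IsPath :=
    Walk.IsCycle.isPath_of_append_right (Walk.not_nil_of_ne hyz) (hspec.symm ▸ hdc)
  have h₁ := (hdc.isPath_takeUntil hzd).girth_le_length_add_two hyz
    (fun h => hxd (d.support_takeUntil_subset_support hzd h)) hxy hxz
  have h₂ := hdrop.girth_le_length_add_two hyz.symm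
    (fun h => hxd (d.support_dropUntil_subset_support hzd h)) hxz hxy
  have hlen := congrArg Walk.length hspec
  have hrot : d.length = c.length := c.length_rotate y hy
  rw [Walk.length_append] at hlen
  omega

end SimpleGraph

/-- Let `G` be connected with girth `g ≥ 5`, `g ≡ 0, 1 (mod 4)`, not a canonical
unicyclic graph, with `n(G) = ⌈g/2⌉`, and let `C` be a shortest cycle. Then every
vertex at distance exactly `1` from `V(C)` has exactly one neighbor on `C`. -/
theorem unique_neighbor_of_dist_one {V : Type*} [Fintype V] (G : SimpleGraph V)
    (hG : G.Connected) (g : ℕ) (hgirth : G.girth = g) (hg : 5 ≤ g)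
    (hmod : g % 4 = 0 ∨ g % 4 = 1) (hnc : ¬ G.IsCanonicalUnicyclic)
    (hn : G.negInertia = (g + 1) / 2)
    {a : V} (c : G.Walk a a) (hc : c.IsCycle) (hclen : c.length = g) :
    ∀ x : V, x ∉ c.support → (∃ y ∈ c.support, G.Adj x y) →
      ∃! y : V, y ∈ c.support ∧ G.Adj x y := by
  rintro x hx ⟨y, hy, hxy⟩
  refine ⟨y, ⟨hy, hxy⟩, fun z ⟨hz, hxz⟩ => ?_⟩
  by_contra hzy
  have := hc.two_mul_girth_le_length_add_four hx hz hy hzy hxz hxy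
  omega
end
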